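/- arXiv:1409.2034 — 3 statements merged into one kernel-verified Lean document; each statement's English description precedes it below -/
import Mathlib

section
/- Let S(m) denote the number of vectors (b_1, …, b_m) ∈ {−1,1}^m satisfying Σ_{i=1}^m b_i = 0 and Σ_{i=1}^m i·b_i = 0. Then as m → ∞ along multiples of 4, m² · S(m) / 2^m → 4√3/π. -/
open Filter

/-- `S(m)`: the number of sign vectors `(b_1, …, b_m) ∈ {-1,1}^m` with
`∑ b_i = 0` and `∑ i·b_i = 0` (second-order spectral-null codewords of length `m`). -/
noncomputable def spectralNullCount (m : ℕ) : ℕ :=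
  Nat.card {b : Fin m → ℤ // (∀ i, b i = 1 ∨ b i = -1) ∧
    (∑ i : Fin m, b i) = 0 ∧ (∑ i : Fin m, ((i : ℤ) + 1) * b i) = 0}

noncomputable def cc (m j : ℕ) : ℝ := (j:ℝ) - ((m:ℝ)-1)/2

lemma sum_gen (a : ℝ) (n : ℕ) : ∑ j ∈ Finset.range n, ((j:ℝ) - a)^2 =
    (n:ℝ)*(n-1)*(2*n-1)/6 - a*n*(n-1) + n*a^2 := by
  induction n with
  | zero => simp
  | succ n ih => rw [Finset.sum_range_succ, ih]; push_cast; ring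

lemma sum_cc_sq (m : ℕ) : ∑ j ∈ Finset.range m, (cc m j)^2 = (m:ℝ)*(m^2-1)/12 := by
  unfold cc; rw [sum_gen]; ring

lemma cc_abs (m j : ℕ) (h : j ∈ Finset.range m) : |cc m j| ≤ m/2 := by
  have : (j:ℝ) + 1 ≤ m := by exact_mod_cast Finset.mem_range.mp h
  have h0 : (0:ℝ) ≤ j := Nat.cast_nonneg j
  unfold cc; rw [abs_le]; constructor <;> linarith

noncomputable def DD (m : ℕ) (β : ℝ) : ℝ := ∑ j ∈ Finset.range m, Real.cos (2 * (cc m j * β))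

lemma sin_gen (a β : ℝ) (n : ℕ) : Real.sin β * ∑ j ∈ Finset.range n, Real.cos (2 * (((j:ℝ)-a) * β))
    = (Real.sin ((2*n-1-2*a)*β) + Real.sin ((1+2*a)*β))/2 := by
  induction n with
  | zero =>
    simp only [Finset.range_zero, Finset.sum_empty]
    rw [show (2*((0:ℕ):ℝ)-1-2*a)*β = -((1+2*a)*β) by push_cast; ring, Real.sin_neg]; ring
  | succ n ih =>
    rw [Finset.sum_range_succ, mul_add, ih]
    rw [show (2*((n+1:ℕ):ℝ)-1-2*a)*β = 2 * (((n:ℝ)-a) * β) + β by push_cast; ring,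
      show (2*((n:ℕ):ℝ)-1-2*a)*β = 2 * (((n:ℝ)-a) * β) - β by ring, Real.sin_add, Real.sin_sub]
    ring

lemma sin_DD (m : ℕ) (β : ℝ) : Real.sin β * DD m β = Real.sin (m*β) := by
  unfold DD cc; rw [sin_gen]
  rw [show (2*(m:ℝ)-1-2*(((m:ℝ)-1)/2))*β = m*β by ring,
    show (1+2*(((m:ℝ)-1)/2))*β = m*β by ring]; ring

lemma sum_sin (m : ℕ) (β : ℝ) : ∑ j ∈ Finset.range m, Real.sin (2 * (cc m j * β)) = 0 := by
  have h := Finset.sum_range_reflect (fun j => Real.sin (2 * (cc m j * β))) m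
  have h2 : ∑ j ∈ Finset.range m, Real.sin (2 * (cc m (m-1-j) * β)) =
      - ∑ j ∈ Finset.range m, Real.sin (2 * (cc m j * β)) := by
    rw [← Finset.sum_neg_distrib]
    refine Finset.sum_congr rfl fun j hj => ?_
    rw [← Real.sin_neg]; congr 1
    have : j + 1 ≤ m := Finset.mem_range.mp hj
    unfold cc
    rw [show m - 1 - j = m - (j+1) by omega, Nat.cast_sub this]; push_cast; ring
  linarith

lemma sum_sinsq (m : ℕ) (α β : ℝ) : ∑ j ∈ Finset.range m, (Real.sin (α + cc m j * β))^2
    = (m - Real.cos (2*α) * DD m β)/2 := by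
  have : ∀ j ∈ Finset.range m, (Real.sin (α + cc m j * β))^2 =
      1/2 - Real.cos (2*α)/2 * Real.cos (2 * (cc m j * β))
       + Real.sin (2*α)/2 * Real.sin (2 * (cc m j * β)) := by
    intro j _
    rw [Real.sin_sq_eq_half_sub, mul_add, Real.cos_add]; ring
  rw [Finset.sum_congr rfl this, Finset.sum_add_distrib, Finset.sum_sub_distrib,
    ← Finset.mul_sum, ← Finset.mul_sum, sum_sin]
  simp [DD]; ring

lemma DD_neg (m : ℕ) (β : ℝ) : DD m (-β) = DD m β := by
  unfold DD; refine Finset.sum_congr rfl fun j _ => ?_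
  rw [← Real.cos_neg]; congr 1; ring

lemma DD_lower (m : ℕ) (β : ℝ) (h0 : 0 ≤ β) (h1 : β ≤ Real.pi/2) :
    -((m:ℝ)/2) ≤ DD m β ∧ (m*β ≤ Real.pi ∨ DD m β ≤ m/2) := by
  have hm : (0:ℝ) ≤ m := Nat.cast_nonneg m
  have hp := Real.pi_pos
  have hs := Real.mul_le_sin h0 h1
  have hD := sin_DD m β
  rcases h0.eq_or_lt with rfl | hb
  · simp [DD]; constructor
    · linarith
    · left; positivity
  have hsp : 0 < Real.sin β := lt_of_lt_of_le (by positivity) hs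
  by_cases hmb : m*β ≤ Real.pi
  · refine ⟨?_, Or.inl hmb⟩
    have := Real.sin_nonneg_of_nonneg_of_le_pi (by positivity) hmb
    rw [← hD] at this
    have := nonneg_of_mul_nonneg_right this hsp
    linarith
  · push Not at hmb
    have h2 : 2 ≤ m * Real.sin β := by
      have : 2 / Real.pi * β * m ≥ 2 := by
        rw [ge_iff_le, show 2 / Real.pi * β * m = 2 * (m*β) / Real.pi by ring, le_div_iff₀ hp]
        linarith
      nlinarith
    have h3 := Real.sin_le_one (m*β)
    have h4 := Real.neg_one_le_sin (m*β)
    rw [← hD] at h3 h4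
    refine ⟨?_, Or.inr ?_⟩
    · by_contra hc; push Not at hc; nlinarith
    · by_contra hc; push Not at hc; nlinarith

lemma DD_upper (m : ℕ) (hm : 2 ≤ m) (β : ℝ) (h : m * |β| ≤ Real.pi) :
    (m:ℝ)^3 * β^2 / (3*Real.pi^2) ≤ m - DD m β := by
  have hm' : (2:ℝ) ≤ m := by exact_mod_cast hm
  have h1 : (m:ℝ) - DD m β = ∑ j ∈ Finset.range m, (1 - Real.cos (2 * (cc m j * β))) := by
    simp [DD]
  have h2 : ∑ j ∈ Finset.range m, (8/Real.pi^2*β^2) * (cc m j)^2 ≤ m - DD m β := by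
    rw [h1]; refine Finset.sum_le_sum fun j hj => ?_
    have hc := cc_abs m j hj
    have : |2 * (cc m j * β)| ≤ Real.pi := by
      rw [abs_mul, abs_mul, abs_two]; nlinarith [abs_nonneg β]
    have := Real.cos_le_one_sub_mul_cos_sq this
    have e : 2 / Real.pi^2 * (2 * (cc m j * β))^2 = (8/Real.pi^2*β^2) * (cc m j)^2 := by ring
    linarith
  rw [← Finset.mul_sum, sum_cc_sq] at h2
  refine le_trans ?_ h2
  have e : 8/Real.pi^2*β^2 * ((m:ℝ)*(m^2-1)/12) - (m:ℝ)^3 * β^2 / (3*Real.pi^2)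
     = β^2/Real.pi^2 * (m * (m^2-2))/3 := by field_simp; ring
  have : 0 ≤ β^2/Real.pi^2 * (m * ((m:ℝ)^2-2))/3 := by
    have : (0:ℝ) ≤ (m:ℝ)^2-2 := by nlinarith
    positivity
  linarith

lemma Q_lower (m : ℕ) (hm : 2 ≤ m) (α β : ℝ) (ha : |α| ≤ Real.pi/2) (hb : |β| ≤ Real.pi/2) :
    (m:ℝ)/4 ≤ (m - Real.cos (2*α) * DD m β)/2 ∨
    (m*α^2 + m^3*β^2)/60 ≤ (m - Real.cos (2*α) * DD m β)/2 := by
  have hp := Real.pi_pos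
  have hp2 : Real.pi^2 < 10 := by nlinarith [Real.pi_lt_d2, Real.pi_gt_three]
  have hm' : (2:ℝ) ≤ m := by exact_mod_cast hm
  have hDe : DD m |β| = DD m β := by
    rcases abs_choice β with h | h <;> rw [h]; rw [DD_neg]
  obtain ⟨h1, h2⟩ := DD_lower m |β| (abs_nonneg _) hb
  rw [hDe] at h1 h2
  have c1 := Real.cos_le_one (2*α)
  have c2 := Real.neg_one_le_cos (2*α)
  by_cases hD : DD m β ≤ m/2
  · left
    have : Real.cos (2*α) * DD m β ≤ m/2 := by
      have h3 : |DD m β| ≤ m/2 := abs_le.mpr ⟨h1, hD⟩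
      have h4 : |Real.cos (2*α)| ≤ 1 := Real.abs_cos_le_one _
      calc _ ≤ |Real.cos (2*α) * DD m β| := le_abs_self _
        _ = |Real.cos (2*α)| * |DD m β| := abs_mul _ _
        _ ≤ 1 * (m/2) := by gcongr
        _ = _ := by ring
    linarith
  · right
    have h3 := h2.resolve_right hD
    have h4 := DD_upper m hm β h3
    push Not at hD
    have hs : 4/Real.pi^2*α^2 ≤ Real.sin α^2 := by
      have := Real.mul_abs_le_abs_sin ha
      have h5 := pow_le_pow_left₀ (by positivity) this 2
      rw [sq_abs, mul_pow, sq_abs] at h5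
      calc _ = (2/Real.pi)^2*α^2 := by ring
        _ ≤ _ := h5
    have hcos : Real.cos (2*α) = 1 - 2*Real.sin α^2 := by
      rw [Real.cos_two_mul, Real.cos_sq']; ring
    have h6 : (m:ℝ)^3*β^2/30 ≤ (m:ℝ)^3 * β^2 / (3*Real.pi^2) := by
      gcongr; linarith
    have h7 : α^2/30 ≤ 4/Real.pi^2*α^2 := by
      rw [div_mul_eq_mul_div, div_le_div_iff₀ (by norm_num) (by positivity)]
      nlinarith [sq_nonneg α]
    rw [hcos]
    have h8 : (m:ℝ) * (α^2/30) ≤ m * Real.sin α^2 := by gcongr; linarith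
    nlinarith [sq_nonneg (Real.sin α)]

lemma prod_le (m : ℕ) (θ : ℕ → ℝ) : |∏ j ∈ Finset.range m, Real.cos (θ j)| ≤
    Real.exp (-(∑ j ∈ Finset.range m, Real.sin (θ j)^2)/2) := by
  rw [Finset.abs_prod, neg_div, Finset.sum_div, ← Finset.sum_neg_distrib, Real.exp_sum]
  refine Finset.prod_le_prod (fun _ _ => abs_nonneg _) fun j _ => ?_
  refine abs_le_of_sq_le_sq ?_ (Real.exp_pos _).le |> fun h => by simpa using h
  rw [← Real.exp_nat_mul, Real.cos_sq']
  have := Real.add_one_le_exp (-(Real.sin (θ j))^2)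
  calc _ ≤ _ := by linarith
    _ = _ := by congr 1; push_cast; ring

noncomputable def FF (m : ℕ) (α β : ℝ) : ℝ := ∏ j ∈ Finset.range m, Real.cos (α + cc m j * β)

lemma FF_bound (m : ℕ) (hm : 2 ≤ m) (α β : ℝ) (ha : |α| ≤ Real.pi/2) (hb : |β| ≤ Real.pi/2) :
    |FF m α β| ≤ 2000000 * ((1+m*α^2)⁻¹ * (1+m^3*β^2)⁻¹) := by
  have hp2 : Real.pi^2 < 10 := by nlinarith [Real.pi_lt_d2, Real.pi_gt_three]
  have hm' : (2:ℝ) ≤ m := by exact_mod_cast hm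
  have h := prod_le m (fun j => α + cc m j * β)
  rw [sum_sinsq] at h
  refine h.trans ?_
  set Q := (m - Real.cos (2*α) * DD m β)/2 with hQ
  have ha2 : α^2 ≤ 2.5 := by
    have := pow_le_pow_left₀ (abs_nonneg _) ha 2
    rw [sq_abs] at this; nlinarith
  have hb2 : β^2 ≤ 2.5 := by
    have := pow_le_pow_left₀ (abs_nonneg _) hb 2
    rw [sq_abs] at this; nlinarith
  rw [← mul_inv, neg_div, Real.exp_neg, ← div_eq_mul_inv, inv_eq_one_div,
    div_le_div_iff₀ (Real.exp_pos _) (by positivity), one_mul]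
  rcases Q_lower m hm α β ha hb with h1 | h1
  · have e1 : (m:ℝ)/8 ≤ Q/2 := by linarith
    have e2 := Real.pow_div_factorial_le_exp ((m:ℝ)/8) (by positivity) 4
    have e3 := Real.exp_le_exp.mpr e1
    have e4 : (1:ℝ)+m*α^2 ≤ 4*m := by nlinarith
    have e5 : (1:ℝ)+m^3*β^2 ≤ 4*m^3 := by
      have : (1:ℝ) ≤ m^3 := one_le_pow₀ (by linarith)
      nlinarith
    calc _ ≤ (4*(m:ℝ))*(4*m^3) := by gcongr
      _ ≤ 2000000 * (((m:ℝ)/8)^4/(Nat.factorial 4)) := by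
        simp [Nat.factorial]; ring_nf; gcongr ?_ * ?_; norm_num
      _ ≤ _ := by gcongr; linarith
  · have e1 : m*α^2/120 + m^3*β^2/120 ≤ Q/2 := by rw [hQ]; linarith
    have e3 := Real.exp_le_exp.mpr e1
    rw [Real.exp_add] at e3
    have e4 := Real.add_one_le_exp (m*α^2/120)
    have e5 := Real.add_one_le_exp (m^3*β^2/120)
    calc _ ≤ (120*Real.exp (m*α^2/120)) * (120 * Real.exp (m^3*β^2/120)) := by
          gcongr <;> linarith
      _ = 14400 * (Real.exp (m*α^2/120) * Real.exp (m^3*β^2/120)) := by ring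
      _ ≤ 14400 * Real.exp (Q/2) := by gcongr
      _ ≤ _ := by gcongr; norm_num

lemma prod_diff (m : ℕ) (a b : ℕ → ℝ) (ha : ∀ j, |a j| ≤ 1) (hb : ∀ j, |b j| ≤ 1) :
    |∏ j ∈ Finset.range m, a j - ∏ j ∈ Finset.range m, b j| ≤ ∑ j ∈ Finset.range m, |a j - b j| := by
  induction m with
  | zero => simp
  | succ n ih =>
    rw [Finset.prod_range_succ, Finset.prod_range_succ, Finset.sum_range_succ]
    have h1 : |∏ j ∈ Finset.range n, a j| ≤ 1 := by
      rw [Finset.abs_prod]; exact Finset.prod_le_one (fun _ _ => abs_nonneg _) fun j _ => ha j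
    set P := ∏ j ∈ Finset.range n, a j
    set R := ∏ j ∈ Finset.range n, b j
    calc |P * a n - R * b n| = |(P - R) * b n + P * (a n - b n)| := by congr 1; ring
      _ ≤ |(P - R) * b n| + |P * (a n - b n)| := abs_add_le _ _
      _ = |P-R| * |b n| + |P| * |a n - b n| := by rw [abs_mul, abs_mul]
      _ ≤ |P-R| * 1 + 1 * |a n - b n| := by gcongr; exact hb n
      _ ≤ _ := by linarith

lemma cos_exp (x : ℝ) (hx : |x| ≤ 1) : |Real.cos x - Real.exp (-x^2/2)| ≤ |x|^4 := by
  have h1 := Real.cos_bound hx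
  have hx2 : x^2 ≤ 1 := by rw [← sq_abs]; exact pow_le_one₀ (abs_nonneg _) hx
  have h2 := Real.abs_exp_sub_one_sub_id_le (x := -x^2/2) (by
    rw [abs_le]; constructor <;> nlinarith [sq_nonneg x])
  have h4 : |x|^4 = x^4 := by rw [show 4 = 2*2 from rfl, pow_mul, sq_abs, ← pow_mul]
  rw [h4] at h1 ⊢
  have h5 : 0 ≤ x^4 := by positivity
  have h6 : (-x^2/2)^2 = x^4/4 := by ring
  rw [h6] at h2
  rw [abs_le] at *
  constructor <;> linarith [h1.1, h1.2, h2.1, h2.2]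

lemma pointwise (u v : ℝ) : Tendsto (fun m : ℕ => FF m (u / √(m:ℝ)) (v / (m * √(m:ℝ)))) atTop
    (nhds (Real.exp (-(1/2)*u^2) * Real.exp (-(1/24) * v^2))) := by
  set K := |u| + |v| with hK
  have hK0 : 0 ≤ K := by positivity
  have hinv : Tendsto (fun m : ℕ => ((m:ℝ))⁻¹) atTop (nhds 0) := tendsto_inv_atTop_nhds_zero_nat
  have hθ : ∀ m : ℕ, 0 < m → ∀ j ∈ Finset.range m,
      |u / √(m:ℝ) + cc m j * (v / (m * √(m:ℝ)))| ≤ K / √(m:ℝ) := by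
    intro m hm j hj
    have hm' : (0:ℝ) < m := by exact_mod_cast hm
    have hs := Real.sqrt_pos.mpr hm'
    have hc := cc_abs m j hj
    have e : u / √(m:ℝ) + cc m j * (v / (m * √(m:ℝ))) = (u + cc m j / m * v)/√(m:ℝ) := by
      field_simp
    rw [e, abs_div, abs_of_pos hs]
    gcongr
    refine (abs_add_le _ _).trans ?_
    rw [abs_mul, abs_div, abs_of_pos hm', hK]
    have : |cc m j| / m ≤ 1 := by rw [div_le_one hm']; linarith
    have := mul_le_mul_of_nonneg_right this (abs_nonneg v)
    linarith
  have hexp : ∀ m : ℕ, 0 < m → ∏ j ∈ Finset.range m,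
      Real.exp (-(u / √(m:ℝ) + cc m j * (v / (m * √(m:ℝ))))^2/2) =
      Real.exp (-(u^2 + v^2*(1-((m:ℝ)⁻¹)^2)/12)/2) := by
    intro m hm
    have hm' : (0:ℝ) < m := by exact_mod_cast hm
    have hs := Real.sqrt_pos.mpr hm'
    have hs2 : √(m:ℝ)^2 = m := Real.sq_sqrt hm'.le
    rw [← Real.exp_sum]; congr 1
    rw [← Finset.sum_div, Finset.sum_neg_distrib]; congr 2
    have hlin : ∑ j ∈ Finset.range m, cc m j = 0 := by
      have : ∀ (a : ℝ) (n : ℕ), ∑ j ∈ Finset.range n, ((j:ℝ) - a) = (n:ℝ)*(n-1)/2 - n*a := by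
        intro a n
        induction n with
        | zero => simp
        | succ n ih => rw [Finset.sum_range_succ, ih]; push_cast; ring
      unfold cc; rw [this]; ring
    have : ∀ j ∈ Finset.range m, (u / √(m:ℝ) + cc m j * (v / (m * √(m:ℝ))))^2 =
        u^2/m + (2*u*v/m^2) * cc m j + v^2/m^3 * (cc m j)^2 := by
      intro j _
      have e : u / √(m:ℝ) + cc m j * (v / (m * √(m:ℝ))) = (u + cc m j / m * v)/√(m:ℝ) := by
        field_simp
      rw [e, div_pow, hs2]; field_simp; ring
    rw [Finset.sum_congr rfl this, Finset.sum_add_distrib, Finset.sum_add_distrib,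
      ← Finset.mul_sum, ← Finset.mul_sum, hlin, sum_cc_sq]
    simp only [Finset.sum_const, Finset.card_range, nsmul_eq_mul]
    field_simp
    ring
  have hlim : Tendsto (fun m : ℕ => Real.exp (-(u^2 + v^2*(1-((m:ℝ)⁻¹)^2)/12)/2)) atTop
      (nhds (Real.exp (-(1/2)*u^2) * Real.exp (-(1/24) * v^2))) := by
    rw [← Real.exp_add]
    have hc : Continuous (fun x : ℝ => Real.exp (-(u^2 + v^2*(1-x^2)/12)/2)) := by fun_prop
    have := (hc.tendsto 0).comp hinv
    rw [show -(1/2)*u^2 + -(1/24)*v^2 = -(u^2 + v^2*(1-0^2)/12)/2 by ring]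
    exact this
  have hdiff : Tendsto (fun m : ℕ => FF m (u / √(m:ℝ)) (v / (m * √(m:ℝ))) -
      Real.exp (-(u^2 + v^2*(1-((m:ℝ)⁻¹)^2)/12)/2)) atTop (nhds 0) := by
    have hb : Tendsto (fun m : ℕ => K^4 * (m:ℝ)⁻¹) atTop (nhds 0) := by
      simpa using hinv.const_mul (K^4)
    refine squeeze_zero_norm' ?_ hb
    filter_upwards [eventually_gt_atTop 0, eventually_ge_atTop (Nat.ceil (K^2))] with m hm hmK
    have hm' : (0:ℝ) < m := by exact_mod_cast hm
    have hs := Real.sqrt_pos.mpr hm'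
    have hs2 : √(m:ℝ)^2 = m := Real.sq_sqrt hm'.le
    have hKm : K ≤ √(m:ℝ) := Real.le_sqrt_of_sq_le (Nat.ceil_le.mp hmK)
    rw [← hexp m hm, Real.norm_eq_abs]
    refine (prod_diff m _ _ (fun j => Real.abs_cos_le_one _) (fun j => ?_)).trans ?_
    · rw [abs_of_pos (Real.exp_pos _), Real.exp_le_one_iff]
      have := sq_nonneg (u / √(m:ℝ) + cc m j * (v / (m * √(m:ℝ))))
      linarith
    · calc _ ≤ ∑ j ∈ Finset.range m, (K/√(m:ℝ))^4 := by
            refine Finset.sum_le_sum fun j hj => ?_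
            have h1 := hθ m hm j hj
            have h2 : K/√(m:ℝ) ≤ 1 := by rwa [div_le_one hs]
            exact (cos_exp _ (h1.trans h2)).trans (pow_le_pow_left₀ (abs_nonneg _) h1 4)
        _ = K^4 * (m:ℝ)⁻¹ := by
            have : √(m:ℝ)^4 = (m:ℝ)^2 := by rw [show 4 = 2*2 from rfl, pow_mul, hs2]
            simp only [Finset.sum_const, Finset.card_range, nsmul_eq_mul]
            rw [div_pow, this]; field_simp
  simpa using hdiff.add hlim

open MeasureTheory in
lemma scaled_limit : Tendsto (fun m : ℕ => ∫ p : ℝ × ℝ,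
    (Set.Ioc (-(Real.pi/2*(m*√(m:ℝ)))) (Real.pi/2*(m*√(m:ℝ))) ×ˢ
      Set.Ioc (-(Real.pi/2*√(m:ℝ))) (Real.pi/2*√(m:ℝ))).indicator
      (fun p : ℝ × ℝ => FF m (p.2 / √(m:ℝ)) (p.1 / (m * √(m:ℝ)))) p) atTop
    (nhds (4 * √3 * Real.pi)) := by
  have hval : ∫ p : ℝ × ℝ, Real.exp (-(1/24) * p.1^2) * Real.exp (-(1/2)*p.2^2) = 4 * √3 * Real.pi := by
    rw [Measure.volume_eq_prod, integral_prod_mul (fun x : ℝ => Real.exp (-(1/24) * x^2))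
      (fun x : ℝ => Real.exp (-(1/2) * x^2)), integral_gaussian, integral_gaussian,
      ← Real.sqrt_mul (by positivity)]
    rw [Real.sqrt_eq_iff_mul_self_eq (by positivity) (by positivity)]
    have : √3*√3 = (3:ℝ) := Real.mul_self_sqrt (by norm_num)
    linear_combination (-16*Real.pi^2) * this
  rw [← hval]
  refine tendsto_integral_filter_of_dominated_convergence
    (fun p => 2000000 * ((1+p.1^2)⁻¹ * (1+p.2^2)⁻¹)) ?_ ?_ ?_ ?_
  · refine Eventually.of_forall fun m => ?_
    refine (Continuous.aestronglyMeasurable ?_).indicator (measurableSet_Ioc.prod measurableSet_Ioc)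
    unfold FF; fun_prop
  · filter_upwards [eventually_ge_atTop 2] with m hm
    refine ae_of_all _ fun p => ?_
    have hm' : (0:ℝ) < m := by exact_mod_cast (by omega : 0 < m)
    have hs := Real.sqrt_pos.mpr hm'
    have hs2 : √(m:ℝ)^2 = m := Real.sq_sqrt hm'.le
    by_cases hp : p ∈ (Set.Ioc (-(Real.pi/2*(m*√(m:ℝ)))) (Real.pi/2*(m*√(m:ℝ))) ×ˢ
      Set.Ioc (-(Real.pi/2*√(m:ℝ))) (Real.pi/2*√(m:ℝ)))
    · rw [Set.indicator_of_mem hp, Real.norm_eq_abs]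
      obtain ⟨⟨h1, h2⟩, h3, h4⟩ := hp
      refine (FF_bound m hm _ _ ?_ ?_).trans (le_of_eq ?_)
      · rw [abs_div, abs_of_pos hs, div_le_iff₀ hs, abs_le]; exact ⟨h3.le, h4⟩
      · rw [abs_div, abs_of_pos (by positivity : 0 < (m:ℝ) * √(m:ℝ)), div_le_iff₀ (by positivity), abs_le]
        exact ⟨h1.le, h2⟩
      · rw [div_pow, div_pow, mul_pow, hs2, mul_comm (_⁻¹)]
        congr 4 <;> field_simp
    · rw [Set.indicator_of_notMem hp, norm_zero]; positivity
  · exact (integrable_inv_one_add_sq.mul_prod integrable_inv_one_add_sq).const_mul _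
  · refine ae_of_all _ fun p => ?_
    have h := pointwise p.2 p.1
    rw [mul_comm] at h
    refine h.congr' ?_
    have ht : Tendsto (fun m : ℕ => √(m:ℝ)) atTop atTop :=
      Real.tendsto_sqrt_atTop.comp tendsto_natCast_atTop_atTop
    filter_upwards [eventually_ge_atTop 1, ht.eventually_ge_atTop (|p.1|+1),
      ht.eventually_ge_atTop (|p.2|+1)] with m hm h1 h2
    have hm' : (1:ℝ) ≤ m := by exact_mod_cast hm
    have hpi := Real.pi_gt_three
    rw [Set.indicator_of_mem]
    have hs0 : 0 ≤ √(m:ℝ) := Real.sqrt_nonneg _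
    have a1 : |p.1| < Real.pi/2*(m*√(m:ℝ)) := by
      have : √(m:ℝ) ≤ m * √(m:ℝ) := by nlinarith
      nlinarith
    have a2 : |p.2| < Real.pi/2*√(m:ℝ) := by nlinarith
    rw [abs_lt] at a1 a2
    exact ⟨⟨a1.1, a1.2.le⟩, a2.1, a2.2.le⟩

open MeasureTheory in
lemma scaled_eq (m : ℕ) (hm : 0 < m) : (∫ p : ℝ × ℝ,
    (Set.Ioc (-(Real.pi/2*(m*√(m:ℝ)))) (Real.pi/2*(m*√(m:ℝ))) ×ˢ
      Set.Ioc (-(Real.pi/2*√(m:ℝ))) (Real.pi/2*√(m:ℝ))).indicator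
      (fun p : ℝ × ℝ => FF m (p.2 / √(m:ℝ)) (p.1 / (m * √(m:ℝ)))) p)
    = (m:ℝ)^2 * ∫ β in (-(Real.pi/2))..(Real.pi/2), ∫ α in (-(Real.pi/2))..(Real.pi/2), FF m α β := by
  have hm' : (0:ℝ) < m := by exact_mod_cast hm
  have hs := Real.sqrt_pos.mpr hm'
  have hs2 : √(m:ℝ)^2 = m := Real.sq_sqrt hm'.le
  have hms : 0 < (m:ℝ) * √(m:ℝ) := by positivity
  have hpi := Real.pi_pos
  rw [integral_indicator (measurableSet_Ioc.prod measurableSet_Ioc), Measure.volume_eq_prod,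
    setIntegral_prod]
  · simp only
    rw [← intervalIntegral.integral_of_le (by nlinarith [mul_pos hpi hms])]
    simp_rw [← intervalIntegral.integral_of_le (show -(Real.pi/2*√(m:ℝ)) ≤ Real.pi/2*√(m:ℝ) by
      nlinarith [mul_pos hpi hs])]
    have e1 : ∀ β : ℝ, ∫ x in (-(Real.pi/2*√(m:ℝ)))..(Real.pi/2*√(m:ℝ)), FF m (x / √(m:ℝ)) β
        = √(m:ℝ) * ∫ α in (-(Real.pi/2))..(Real.pi/2), FF m α β := by
      intro β
      rw [intervalIntegral.integral_comp_div (fun x => FF m x β) hs.ne', smul_eq_mul]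
      congr 2 <;> field_simp
    simp_rw [e1]
    rw [intervalIntegral.integral_const_mul,
      intervalIntegral.integral_comp_div (fun β => ∫ α in (-(Real.pi/2))..(Real.pi/2), FF m α β) hms.ne',
      smul_eq_mul]
    rw [show -(Real.pi/2*(m*√(m:ℝ)))/(m*√(m:ℝ)) = -(Real.pi/2) by field_simp,
      show (Real.pi/2*(m*√(m:ℝ)))/(m*√(m:ℝ)) = (Real.pi/2) by field_simp]
    rw [← mul_assoc]; congr 1
    linear_combination (m:ℝ) * hs2
  · refine IntegrableOn.mono_set ?_ (Set.prod_mono Set.Ioc_subset_Icc_self Set.Ioc_subset_Icc_self)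
    refine ContinuousOn.integrableOn_compact (isCompact_Icc.prod isCompact_Icc) ?_
    apply Continuous.continuousOn
    unfold FF; fun_prop

lemma FF_expand (m : ℕ) (α β : ℝ) : FF m α β = (1/2^m) *
    ∑ b ∈ Fintype.piFinset (fun _ : Fin m => ({1,-1} : Finset ℤ)),
      Real.cos (α * ((∑ i, b i : ℤ) : ℝ) + β * ∑ i : Fin m, cc m i * (b i : ℝ)) := by
  have h1 : FF m α β = ∏ i : Fin m, Real.cos (α + cc m i * β) :=
    (Fin.prod_univ_eq_prod_range (fun j => Real.cos (α + cc m j * β)) m).symm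
  have h2 : ∀ θ : ℝ, ((Real.cos θ : ℝ) : ℂ) =
      (1/2) * ∑ e ∈ ({1,-1} : Finset ℤ), Complex.exp ((e * θ : ℝ) * Complex.I) := by
    intro θ
    rw [Finset.sum_pair (by norm_num), Complex.ofReal_cos, Complex.cos]
    push_cast; ring_nf
  have h3 : ((FF m α β : ℝ) : ℂ) = (1/2^m) *
    ∑ b ∈ Fintype.piFinset (fun _ : Fin m => ({1,-1} : Finset ℤ)),
      Complex.exp ((α * ((∑ i, b i : ℤ) : ℝ) + β * ∑ i : Fin m, cc m i * (b i : ℝ) : ℝ) * Complex.I) := by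
    rw [h1, Complex.ofReal_prod]
    simp_rw [h2]
    rw [Finset.prod_mul_distrib, Finset.prod_univ_sum]
    congr 1
    · simp
    · refine Finset.sum_congr rfl fun b _ => ?_
      rw [← Complex.exp_sum]; congr 1
      rw [← Finset.sum_mul, ← Complex.ofReal_sum]; congr 2
      rw [Int.cast_sum, Finset.mul_sum, Finset.mul_sum, ← Finset.sum_add_distrib]
      refine Finset.sum_congr rfl fun i _ => ?_
      ring
  have h4 := congrArg Complex.re h3
  rw [Complex.ofReal_re] at h4
  rw [h4, show ((1:ℂ)/2^m) = ((1/2^m : ℝ) : ℂ) by push_cast; rfl, Complex.re_ofReal_mul, Complex.re_sum]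
  congr 1
  refine Finset.sum_congr rfl fun b _ => ?_
  rw [Complex.exp_ofReal_mul_I_re]

lemma int_cos (k : ℤ) (t : ℝ) : ∫ α in (-(Real.pi/2))..(Real.pi/2), Real.cos (α * ((2*k : ℤ):ℝ) + t)
    = if k = 0 then Real.pi * Real.cos t else 0 := by
  split_ifs with h
  · subst h; simp
  · have hk : ((2*k : ℤ):ℝ) ≠ 0 := by exact_mod_cast (by omega : 2*k ≠ 0)
    simp_rw [mul_comm _ ((2*k:ℤ):ℝ)]
    rw [intervalIntegral.integral_comp_mul_add (fun x => Real.cos x) hk, integral_cos,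
      show ((2*k:ℤ):ℝ) * (Real.pi/2) + t = t + (k:ℝ) * Real.pi by push_cast; ring,
      show ((2*k:ℤ):ℝ) * (-(Real.pi/2)) + t = t - (k:ℝ) * Real.pi by push_cast; ring,
      Real.sin_add_int_mul_pi, Real.sin_sub_int_mul_pi, sub_self, smul_zero]

lemma even_of (m : ℕ) (hm : 4 ∣ m) (b : Fin m → ℤ) (hb : ∀ i, b i = 1 ∨ b i = -1) :
    (∃ k, ∑ i, b i = 2*k) ∧ ∃ k, ∑ i : Fin m, ((i:ℤ)+1) * b i = 2*k := by
  obtain ⟨n, rfl⟩ := hm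
  have h1 : ∀ i, ∃ k, b i = 1 + 2 * k := by
    intro i; rcases hb i with h | h
    · exact ⟨0, by omega⟩
    · exact ⟨-1, by omega⟩
  choose k hk using h1
  constructor
  · refine ⟨2*n + ∑ i, k i, ?_⟩
    simp_rw [hk, Finset.sum_add_distrib, ← Finset.mul_sum]
    simp; ring
  · have h2 : ∀ N : ℕ, ∑ i ∈ Finset.range (4*N), ((i:ℤ)+1) = 2 * (N*(4*N+1)) := by
      intro N
      induction N with
      | zero => simp
      | succ N ih =>
        rw [show 4*(N+1) = 4*N+1+1+1+1 by ring]
        simp only [Finset.sum_range_succ]; rw [ih]; push_cast; ring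
    refine ⟨n*(4*n+1) + ∑ i : Fin (4*n), ((i:ℤ)+1) * k i, ?_⟩
    have h3 := h2 n
    rw [← Fin.sum_univ_eq_sum_range (fun i => (i:ℤ)+1) (4*n)] at h3
    have h4 : ∀ i : Fin (4*n), ((i:ℤ)+1) * b i = ((i:ℤ)+1) + 2 * (((i:ℤ)+1) * k i) := by
      intro i; rw [hk]; ring
    rw [Finset.sum_congr rfl fun i _ => h4 i, Finset.sum_add_distrib, h3, ← Finset.mul_sum]
    ring

lemma fourier_inv (m : ℕ) (hm : 4 ∣ m) :
    ∫ β in (-(Real.pi/2))..(Real.pi/2), ∫ α in (-(Real.pi/2))..(Real.pi/2), FF m α β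
    = Real.pi^2 * (spectralNullCount m : ℝ) / 2^m := by
  simp_rw [FF_expand]
  set B := Fintype.piFinset (fun _ : Fin m => ({1,-1} : Finset ℤ)) with hB
  have hBm : ∀ b, b ∈ B ↔ ∀ i, b i = 1 ∨ b i = -1 := by
    intro b; simp [hB, Fintype.mem_piFinset]
  have hS : spectralNullCount m = (B.filter (fun b => (∑ i : Fin m, b i) = 0 ∧
      (∑ i : Fin m, ((i : ℤ) + 1) * b i) = 0)).card := by
    unfold spectralNullCount
    refine Nat.subtype_card _ fun b => ?_
    rw [Finset.mem_filter, hBm]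
  simp_rw [intervalIntegral.integral_const_mul]
  have e1 : ∀ β : ℝ, ∫ α in (-(Real.pi/2))..(Real.pi/2), ∑ b ∈ B,
      Real.cos (α * ((∑ i, b i : ℤ) : ℝ) + β * ∑ i : Fin m, cc m i * (b i : ℝ)) =
      ∑ b ∈ B, ∫ α in (-(Real.pi/2))..(Real.pi/2),
      Real.cos (α * ((∑ i, b i : ℤ) : ℝ) + β * ∑ i : Fin m, cc m i * (b i : ℝ)) := by
    intro β
    refine intervalIntegral.integral_finsetSum fun b _ => ?_
    exact Continuous.intervalIntegrable (by fun_prop) _ _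
  simp_rw [e1]
  have e2 : ∀ β : ℝ, ∑ b ∈ B, ∫ α in (-(Real.pi/2))..(Real.pi/2),
      Real.cos (α * ((∑ i, b i : ℤ) : ℝ) + β * ∑ i : Fin m, cc m i * (b i : ℝ)) =
      ∑ b ∈ B, if ∑ i, b i = 0 then
        Real.pi * Real.cos (β * ((∑ i : Fin m, ((i : ℤ) + 1) * b i : ℤ) : ℝ) + 0) else 0 := by
    intro β
    refine Finset.sum_congr rfl fun b hb => ?_
    obtain ⟨k, hk⟩ := (even_of m hm b ((hBm b).mp hb)).1
    have hW : (∑ i : Fin m, cc m i * (b i : ℝ)) = ((∑ i : Fin m, ((i : ℤ) + 1) * b i : ℤ) : ℝ)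
        - ((m:ℝ)+1)/2 * ((∑ i, b i : ℤ):ℝ) := by
      push_cast
      rw [Finset.mul_sum, ← Finset.sum_sub_distrib]
      refine Finset.sum_congr rfl fun i _ => ?_
      unfold cc; ring
    rw [hW, hk, int_cos]
    by_cases h0 : k = 0
    · subst h0; simp
    · rw [if_neg h0, if_neg (by omega)]
  simp_rw [e2]
  rw [intervalIntegral.integral_finsetSum]
  · have e3 : ∀ b ∈ B, (∫ β in (-(Real.pi/2))..(Real.pi/2), if ∑ i, b i = 0 then
        Real.pi * Real.cos (β * ((∑ i : Fin m, ((i : ℤ) + 1) * b i : ℤ) : ℝ) + 0) else 0)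
        = if ((∑ i : Fin m, b i) = 0 ∧ (∑ i : Fin m, ((i : ℤ) + 1) * b i) = 0) then Real.pi^2 else 0 := by
      intro b hb
      obtain ⟨k, hk⟩ := (even_of m hm b ((hBm b).mp hb)).2
      by_cases h : ∑ i, b i = 0
      · simp only [h, if_true, true_and]
        rw [intervalIntegral.integral_const_mul, hk, int_cos]
        by_cases h0 : k = 0
        · subst h0; simp; ring
        · rw [if_neg h0, if_neg (by omega), mul_zero]
      · simp [h]
    rw [Finset.sum_congr rfl e3, ← Finset.sum_filter, Finset.sum_const, ← hS, nsmul_eq_mul]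
    ring
  · intro b _
    refine Continuous.intervalIntegrable ?_ _ _
    split_ifs <;> fun_prop

/-- Along multiples of 4, `m² · S(m) / 2^m → 4√3/π`. -/
theorem spectral_null_asymptotics :
    Tendsto (fun m : ℕ => (m : ℝ) ^ 2 * (spectralNullCount m : ℝ) / 2 ^ m)
      (atTop ⊓ Filter.principal {m : ℕ | 4 ∣ m})
      (nhds (4 * Real.sqrt 3 / Real.pi)) := by
  have h := (scaled_limit.mono_left
    (inf_le_left : atTop ⊓ Filter.principal {m : ℕ | 4 ∣ m} ≤ atTop)).div_const (Real.pi^2)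
  have hpi := Real.pi_pos
  rw [show 4 * √3 * Real.pi / Real.pi^2 = 4 * √3 / Real.pi by field_simp] at h
  refine h.congr' ?_
  have h1 : ∀ᶠ m in atTop ⊓ Filter.principal {m : ℕ | 4 ∣ m}, 0 < m :=
    (eventually_gt_atTop 0).filter_mono inf_le_left
  have h2 : ∀ᶠ m in atTop ⊓ Filter.principal {m : ℕ | 4 ∣ m}, 4 ∣ m :=
    (mem_inf_of_right (mem_principal_self _) : {m : ℕ | 4 ∣ m} ∈ _)
  filter_upwards [h1, h2] with m hm0 hm4
  rw [scaled_eq m hm0, fourier_inv m hm4]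
  field_simp
end

section
/- Assume condition (C). For every A > 0 there exists n₀ such that for all n ≥ n₀, the probability that P_n has a root α ∈ ℂ which is a nonzero algebraic integer of degree at most A·log n over ℚ and which is not a root of unity is at most exp( − n/(log n)³ ). -/
open MeasureTheory

/-- The polynomial `∑_{j=0}^n a_j z^j` with integer coefficients, viewed over `ℂ`. -/
noncomputable def polyOf (n : ℕ) (a : Fin (n + 1) → ℤ) : Polynomial ℂ :=
  ∑ j : Fin (n + 1), Polynomial.C (a j : ℂ) * Polynomial.X ^ (j : ℕ)

open Polynomial in
lemma aux_trace_cong {K : Type*} [Field K] [NumberField K] (y : K) (hy : IsIntegral ℤ y)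
    (p : ℕ) (hp : p.Prime) :
    ∃ z : ℤ, Algebra.trace ℚ K (y ^ p) - Algebra.trace ℚ K y = p * z := by
  have := Fact.mk hp
  let y' : NumberField.RingOfIntegers K := ⟨y, hy⟩
  have h1 : Algebra.trace ℚ K y = ((Algebra.trace ℤ _ y' : ℤ) : ℚ) := by
    rw [Algebra.coe_trace_int]; rfl
  have h2 : Algebra.trace ℚ K (y ^ p) = ((Algebra.trace ℤ _ (y' ^ p) : ℤ) : ℚ) := by
    rw [Algebra.coe_trace_int]; rfl
  have h3 : (p : ℤ) ∣ Algebra.trace ℤ _ (y' ^ p) - Algebra.trace ℤ _ y' := by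
    rw [← ZMod.intCast_zmod_eq_zero_iff_dvd]
    classical
    let b := NumberField.RingOfIntegers.basis K
    rw [Algebra.trace_eq_matrix_trace b, Algebra.trace_eq_matrix_trace b, map_pow]
    push_cast
    have key := ZMod.trace_pow_card (p := p)
      ((Algebra.leftMulMatrix b y').map (Int.castRingHom (ZMod p)))
    have e1 : ∀ M : Matrix _ _ ℤ, ((Matrix.trace M : ℤ) : ZMod p) =
      Matrix.trace ((Int.castRingHom (ZMod p)).mapMatrix M) (n := Module.Free.ChooseBasisIndex ℤ (NumberField.RingOfIntegers K)) := by
      intro M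
      simp [Matrix.trace]
    rw [e1, e1, map_pow]
    rw [RingHom.mapMatrix_apply, key, ZMod.pow_card, sub_self]
  obtain ⟨z, hz⟩ := h3
  refine ⟨z, ?_⟩
  rw [h1, h2]
  exact_mod_cast hz

lemma aux_one_le_prod {ι : Type*} (s : Finset ι) (f : ι → ℝ) (hf : ∀ i, 1 ≤ f i) :
    1 ≤ ∏ i ∈ s, f i :=
  Finset.prod_induction f (fun a => 1 ≤ a) (fun _ _ ha hb => one_le_mul_of_one_le_of_one_le ha hb)
    le_rfl (fun i _ => hf i)

lemma aux_sum_le_prod {ι : Type*} (s : Finset ι) (f : ι → ℝ) (hf : ∀ i, 1 ≤ f i) :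
    ∑ i ∈ s, f i ≤ (s.card : ℝ) - 1 + ∏ i ∈ s, f i := by
  classical
  induction s using Finset.induction_on with
  | empty => simp
  | insert a s ha ih =>
    rw [Finset.sum_insert ha, Finset.prod_insert ha, Finset.card_insert_of_notMem ha]
    have h1 : 1 ≤ ∏ i ∈ s, f i := aux_one_le_prod s f hf
    push_cast
    nlinarith [hf a]

lemma aux_trace_bound {K : Type*} [Field K] [NumberField K] (x : K) (j N : ℕ) (hj : j ≤ N)
    (hM : (∏ σ : K →ₐ[ℚ] ℂ, max 1 ‖σ x‖) ^ N ≤ Module.finrank ℚ K + 1) :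
    |((Algebra.trace ℚ K (x ^ j) : ℚ) : ℝ)| ≤ 2 * Module.finrank ℚ K := by
  have h1 : ((Algebra.trace ℚ K (x ^ j) : ℚ) : ℂ) = ∑ σ : K →ₐ[ℚ] ℂ, σ (x ^ j) :=
    (trace_eq_sum_embeddings (K := ℚ) (L := K) ℂ (x := x ^ j))
  have h2 : |((Algebra.trace ℚ K (x ^ j) : ℚ) : ℝ)| = ‖∑ σ : K →ₐ[ℚ] ℂ, σ (x ^ j)‖ := by
    rw [← h1]; simp
  have hge : ∀ σ : K →ₐ[ℚ] ℂ, 1 ≤ max 1 ‖σ x‖ := fun σ => le_max_left _ _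
  rw [h2]
  calc ‖∑ σ : K →ₐ[ℚ] ℂ, σ (x ^ j)‖ ≤ ∑ σ : K →ₐ[ℚ] ℂ, ‖σ (x ^ j)‖ := norm_sum_le _ _
    _ ≤ ∑ σ : K →ₐ[ℚ] ℂ, (max 1 ‖σ x‖) ^ N := by
      refine Finset.sum_le_sum fun σ _ => ?_
      rw [map_pow, norm_pow]
      exact (pow_le_pow_left₀ (norm_nonneg _) (le_max_right _ _) _).trans
        (pow_le_pow_right₀ (hge σ) hj)
    _ ≤ _ := aux_sum_le_prod _ _ (fun σ => one_le_pow₀ (hge σ))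
    _ ≤ _ := by
      rw [Finset.prod_pow, Finset.card_univ, AlgHom.card]
      linarith

open Polynomial in
lemma aux_dobrowolski {K : Type*} [Field K] [NumberField K] (x : K) (hx : IsIntegral ℤ x)
    (hx0 : x ≠ 0) (hru : ¬ ∃ k : ℕ, 1 ≤ k ∧ x ^ k = 1) :
    (Module.finrank ℚ K : ℝ) + 1 <
      (∏ σ : K →ₐ[ℚ] ℂ, max 1 ‖σ x‖) ^ (16 * (Module.finrank ℚ K) ^ 2) := by
  by_contra hcon
  push Not at hcon
  set d := Module.finrank ℚ K with hd
  have hdpos : 0 < d := Module.finrank_pos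
  obtain ⟨p, hp, hp1, hp2⟩ := Nat.exists_prime_lt_and_le_two_mul (4 * d) (by omega)
  have hbd : ∀ j, j ≤ 16 * d ^ 2 → |((Algebra.trace ℚ K (x ^ j) : ℚ) : ℝ)| ≤ 2 * d :=
    fun j hj => aux_trace_bound x j _ hj hcon
  have htr : ∀ j, j < 2 * d → Algebra.trace ℚ K ((x ^ p) ^ j) = Algebra.trace ℚ K (x ^ j) := by
    intro j hj
    obtain ⟨z, hz⟩ := aux_trace_cong (x ^ j) (hx.pow j) p hp
    have e : (x ^ p) ^ j = (x ^ j) ^ p := by rw [← pow_mul, ← pow_mul, mul_comm]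
    rw [e]
    have b1 := hbd (j * p) (by nlinarith)
    have b2 := hbd j (by nlinarith)
    rw [pow_mul] at b1
    have hz' : ((Algebra.trace ℚ K ((x ^ j) ^ p) : ℚ) : ℝ) - ((Algebra.trace ℚ K (x ^ j) : ℚ) : ℝ)
      = p * z := by exact_mod_cast congrArg (fun q : ℚ => (q : ℝ)) hz
    have hz0 : z = 0 := by
      by_contra hne
      have : (1 : ℝ) ≤ |(z : ℝ)| := by exact_mod_cast Int.one_le_abs hne
      have h3 : |(p * z : ℝ)| ≤ 4 * d := by
        rw [← hz']; refine (abs_sub _ _).trans ?_; linarith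
      rw [abs_mul, Nat.abs_cast] at h3
      have : (4 * d : ℝ) < p := by exact_mod_cast hp1
      nlinarith [Nat.cast_nonneg (α := ℝ) d]
    rw [hz0] at hz
    simp at hz
    linarith
  have hpoly : ∀ q : ℚ[X], q.natDegree < 2 * d →
      Algebra.trace ℚ K (aeval (x ^ p) q) = Algebra.trace ℚ K (aeval x q) := by
    intro q hq
    rw [aeval_eq_sum_range' hq, aeval_eq_sum_range' hq, map_sum, map_sum]
    refine Finset.sum_congr rfl fun j hj => ?_
    rw [map_smul, map_smul, htr j (Finset.mem_range.1 hj)]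
  set f := minpoly ℚ x with hf
  have hroot : aeval (x ^ p) f = 0 := by
    by_contra hne
    have hint : IsIntegral ℚ (x ^ p) := Algebra.IsIntegral.isIntegral _
    have hmem : (aeval (x ^ p) f)⁻¹ ∈ Algebra.adjoin ℚ {x ^ p} := by
      have h1 : aeval (x ^ p) f ∈ Algebra.adjoin ℚ {x ^ p} := aeval_mem_adjoin_singleton _ _
      exact Subalgebra.inv_mem_of_algebraic (Algebra.adjoin ℚ {x ^ p}) (x := ⟨_, h1⟩)
        (Algebra.IsAlgebraic.isAlgebraic _)
    rw [Algebra.adjoin_singleton_eq_range_aeval] at hmem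
    obtain ⟨g, hg⟩ := hmem
    have hg' : aeval (x ^ p) (g %ₘ minpoly ℚ (x ^ p)) = (aeval (x ^ p) f)⁻¹ := by
      rw [← hg]
      exact aeval_modByMonic_eq_self_of_root (minpoly.aeval _ _)
    set h := g %ₘ minpoly ℚ (x ^ p) with hh
    have hdeg : h.natDegree < d := 
      (natDegree_modByMonic_lt _ (minpoly.monic hint) (minpoly.ne_one _ _)).trans_le
        (minpoly.natDegree_le _)
    have hfd : f.natDegree ≤ d := minpoly.natDegree_le _
    have := hpoly (f * h) (natDegree_mul_le.trans_lt (by omega))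
    rw [map_mul (aeval (x ^ p)), map_mul (aeval x), hg', mul_inv_cancel₀ hne, hf, minpoly.aeval, zero_mul, map_zero] at this
    rw [← map_one (algebraMap ℚ K), Algebra.trace_algebraMap] at this
    simp at this
    omega
  have hdvd : f ∣ expand ℚ p f := by
    apply minpoly.dvd
    rw [expand_aeval, hroot]
  have hiter : ∀ i, aeval (x ^ (p ^ i)) f = 0 := by
    intro i
    induction i with
    | zero => simp [hf]
    | succ i ih =>
      have := aeval_eq_zero_of_dvd_aeval_eq_zero hdvd ih
      rwa [expand_aeval, ← pow_mul, ← pow_succ] at this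
  have hf0 : f ≠ 0 := minpoly.ne_zero (Algebra.IsIntegral.isIntegral _)
  have hfin : (f.rootSet K).Finite := rootSet_finite _ _
  have hmaps : Set.MapsTo (fun i : ℕ => x ^ (p ^ i)) Set.univ (f.rootSet K) := by
    intro i _
    exact (mem_rootSet.2 ⟨hf0, hiter i⟩)
  obtain ⟨i, _, j, _, hij, he⟩ := Set.infinite_univ.exists_lt_map_eq_of_mapsTo hmaps hfin
  have hlt : p ^ i < p ^ j := Nat.pow_lt_pow_right hp.one_lt hij
  refine hru ⟨p ^ j - p ^ i, by omega, ?_⟩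
  have he' : x ^ (p ^ i) = x ^ (p ^ j) := he
  have : x ^ (p ^ i) * x ^ (p ^ j - p ^ i) = x ^ (p ^ i) * 1 := by
    rw [← pow_add, Nat.add_sub_cancel' hlt.le, mul_one, he']
  exact mul_left_cancel₀ (pow_ne_zero _ hx0) this

lemma aux_inj {K : Type*} [Field K] [NumberField K] (x : K) (hx0 : x ≠ 0)
    (k : ℕ) (hk : k.Prime) (hkd : (Module.finrank ℚ K) ^ 2 + 1 < k) (σ τ : K →ₐ[ℚ] ℂ)
    (h : σ x ^ k = τ x ^ k) : σ x = τ x := by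
  by_contra hne
  have hτ : τ x ≠ 0 := by simpa using hx0
  set ζ := σ x / τ x with hζ
  have h1 : ζ ^ k = 1 := by rw [hζ, div_pow, h, div_self (pow_ne_zero _ hτ)]
  have h2 : ζ ≠ 1 := by
    intro h3; apply hne; rwa [hζ, div_eq_one_iff_eq hτ] at h3
  have hprim : IsPrimitiveRoot ζ k := by
    have := Fact.mk hk
    exact IsPrimitiveRoot.iff_orderOf.2 (orderOf_eq_prime h1 h2)
  have hdeg : (minpoly ℚ ζ).natDegree = k - 1 := by
    rw [← Polynomial.cyclotomic_eq_minpoly_rat hprim hk.pos, Polynomial.natDegree_cyclotomic,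
      Nat.totient_prime hk]
  let E := σ.fieldRange ⊔ τ.fieldRange
  have hmem : ζ ∈ E := by
    apply div_mem
    · exact (le_sup_left : σ.fieldRange ≤ E) ⟨x, rfl⟩
    · exact (le_sup_right : τ.fieldRange ≤ E) ⟨x, rfl⟩
  have e1 : Module.finrank ℚ σ.fieldRange = Module.finrank ℚ K :=
    (AlgEquiv.ofInjectiveField σ).toLinearEquiv.finrank_eq.symm
  have e2 : Module.finrank ℚ τ.fieldRange = Module.finrank ℚ K :=
    (AlgEquiv.ofInjectiveField τ).toLinearEquiv.finrank_eq.symm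
  have : FiniteDimensional ℚ σ.fieldRange :=
    (AlgEquiv.ofInjectiveField σ).toLinearEquiv.finiteDimensional
  have : FiniteDimensional ℚ τ.fieldRange :=
    (AlgEquiv.ofInjectiveField τ).toLinearEquiv.finiteDimensional
  have : FiniteDimensional ℚ E := IntermediateField.finiteDimensional_sup _ _
  have h4 : Module.finrank ℚ E ≤ _ := IntermediateField.finrank_sup_le σ.fieldRange τ.fieldRange
  rw [e1, e2] at h4
  have h5 : (minpoly ℚ (⟨ζ, hmem⟩ : E)).natDegree ≤ Module.finrank ℚ E := minpoly.natDegree_le _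
  have h6 : minpoly ℚ (⟨ζ, hmem⟩ : E) = minpoly ℚ ζ :=
    (minpoly.algebraMap_eq (algebraMap E ℂ).injective (⟨ζ, hmem⟩ : E)).symm
  rw [h6, hdeg] at h5
  rw [pow_two] at hkd
  omega

lemma aux_mahler_bound (R : Polynomial ℤ) (n : ℕ) (B : ℝ) (hR : R.natDegree ≤ n)
    (hB : ∀ i, |(R.coeff i : ℝ)| ≤ B) :
    (R.map (Int.castRingHom ℂ)).mahlerMeasure ≤ (n + 1) * B := by
  refine (Polynomial.mahlerMeasure_le_sum_norm_coeff _).trans ?_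
  rw [Polynomial.sum_over_range' _ (by simp) (n + 1)
    ((Polynomial.natDegree_map_le).trans_lt (by omega))]
  calc _ ≤ ∑ i ∈ Finset.range (n + 1), B := by
        refine Finset.sum_le_sum fun i _ => ?_
        simpa using hB i
    _ = _ := by simp

open Polynomial IntermediateField in
lemma aux_height (α : ℂ) (hα : IsIntegral ℤ α) (hα0 : α ≠ 0)
    (hru : ¬ ∃ k : ℕ, 1 ≤ k ∧ α ^ k = 1) (k : ℕ) (hk : k.Prime)
    (hkd : (minpoly ℚ α).natDegree ^ 2 + 1 < k) (Q : ℤ[X]) (hQ : Q ≠ 0)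
    (hroot : aeval (α ^ k) Q = 0) (B : ℝ) (hB : (Q.map (Int.castRingHom ℂ)).mahlerMeasure ≤ B) :
    k * Real.log ((minpoly ℚ α).natDegree + 1) ≤
      16 * ((minpoly ℚ α).natDegree : ℝ) ^ 2 * Real.log B := by
  have hαQ : IsIntegral ℚ α := hα.tower_top
  have hfd : FiniteDimensional ℚ ℚ⟮α⟯ := adjoin.finiteDimensional hαQ
  have hnf : NumberField ℚ⟮α⟯ := { to_charZero := inferInstance, to_finiteDimensional := hfd }
  have hd : Module.finrank ℚ ℚ⟮α⟯ = (minpoly ℚ α).natDegree := adjoin.finrank hαQ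
  set x : ℚ⟮α⟯ := AdjoinSimple.gen ℚ α with hx
  have hxα : algebraMap ℚ⟮α⟯ ℂ x = α := AdjoinSimple.algebraMap_gen ℚ α
  have hinj : Function.Injective (algebraMap ℚ⟮α⟯ ℂ) := (algebraMap ℚ⟮α⟯ ℂ).injective
  have hxint : IsIntegral ℤ x := by
    rw [← isIntegral_algebraMap_iff hinj (R := ℤ), hxα]; exact hα
  have hx0 : x ≠ 0 := by
    intro h; rw [h, map_zero] at hxα; exact hα0 hxα.symm
  have hxru : ¬ ∃ k : ℕ, 1 ≤ k ∧ x ^ k = 1 := by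
    rintro ⟨j, hj, h⟩
    exact hru ⟨j, hj, by rw [← hxα, ← map_pow, h, map_one]⟩
  have key := aux_dobrowolski x hxint hx0 hxru
  rw [← hd] at hkd
  have hσ : Function.Injective (fun σ : ℚ⟮α⟯ →ₐ[ℚ] ℂ => σ x ^ k) := by
    intro σ τ h
    have := aux_inj x hx0 k hk hkd σ τ h
    exact IntermediateField.algHom_ext_of_eq_adjoin _ rfl (by
      intro y hy
      have hy' : y = α := hy
      subst y
      exact this)
  set QC := Q.map (Int.castRingHom ℂ) with hQC
  have hQC0 : QC ≠ 0 := by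
    rw [hQC]; rwa [Ne, Polynomial.map_eq_zero_iff (Int.castRingHom ℂ).injective_int]
  have hxk : aeval (x ^ k) Q = 0 := by
    apply hinj
    rw [map_zero, ← aeval_algebraMap_apply, map_pow, hxα, hroot]
  have hmem : ∀ σ : ℚ⟮α⟯ →ₐ[ℚ] ℂ, σ x ^ k ∈ QC.roots := by
    intro σ
    rw [mem_roots hQC0, IsRoot.def, hQC, eval_map, ← map_pow]
    have : (σ : ℚ⟮α⟯ →+* ℂ) (aeval (x ^ k) Q) = 0 := by rw [hxk, map_zero]
    rw [aeval_def, hom_eval₂] at this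
    rw [RingHom.ext_int ((σ : ℚ⟮α⟯ →+* ℂ).comp (algebraMap ℤ ℚ⟮α⟯)) (Int.castRingHom ℂ)] at this
    exact this
  classical
  have hle : (∏ σ : ℚ⟮α⟯ →ₐ[ℚ] ℂ, max 1 ‖σ x‖) ^ k ≤ QC.mahlerMeasure := by
    have h1 : ∀ σ : ℚ⟮α⟯ →ₐ[ℚ] ℂ, (max 1 ‖σ x‖) ^ k = max 1 ‖σ x ^ k‖ := by
      intro σ
      rw [norm_pow]
      rcases le_total 1 ‖σ x‖ with h | h
      · rw [max_eq_right h, max_eq_right (one_le_pow₀ h)]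
      · rw [max_eq_left h, max_eq_left (pow_le_one₀ (norm_nonneg _) h), one_pow]
    rw [← Finset.prod_pow, Finset.prod_congr rfl (fun σ _ => h1 σ)]
    have hlc : 1 ≤ ‖QC.leadingCoeff‖ := by
      rw [hQC, leadingCoeff_map_of_injective (Int.castRingHom ℂ).injective_int, eq_intCast]
      norm_cast
      exact Int.one_le_abs <| leadingCoeff_ne_zero.mpr hQ
    refine le_trans ?_ (prod_max_one_norm_roots_le_mahlerMeasure_of_one_le_leadingCoeff hlc)
    have h2 : (Finset.univ.val.map (fun σ : ℚ⟮α⟯ →ₐ[ℚ] ℂ => σ x ^ k)) ≤ QC.roots := by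
      rw [Multiset.le_iff_subset (Multiset.Nodup.map hσ Finset.univ.nodup)]
      intro y hy
      obtain ⟨σ, _, rfl⟩ := Multiset.mem_map.1 hy
      exact hmem σ
    obtain ⟨u, hu⟩ := Multiset.le_iff_exists_add.1 h2
    rw [hu, Multiset.map_add, Multiset.prod_add, Multiset.map_map]
    have h3 : 1 ≤ (u.map (fun a : ℂ => max 1 ‖a‖)).prod := by
      refine Multiset.prod_induction (fun a : ℝ => 1 ≤ a) _
        (fun _ _ ha hb => one_le_mul_of_one_le_of_one_le ha hb) le_rfl ?_
      intro a ha
      obtain ⟨b, _, rfl⟩ := Multiset.mem_map.1 ha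
      exact le_max_left _ _
    have h4 : 0 ≤ ∏ σ : ℚ⟮α⟯ →ₐ[ℚ] ℂ, max 1 ‖σ x ^ k‖ :=
      Finset.prod_nonneg (fun σ _ => zero_le_one.trans (le_max_left _ _))
    exact le_mul_of_one_le_right h4 h3
  set M := ∏ σ : ℚ⟮α⟯ →ₐ[ℚ] ℂ, max 1 ‖σ x‖ with hM
  have hM1 : 1 ≤ M := aux_one_le_prod _ _ (fun σ => le_max_left _ _)
  rw [hd] at key
  set d := (minpoly ℚ α).natDegree
  have l1 : Real.log (d + 1) ≤ (16 * d ^ 2 : ℕ) * Real.log M := by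
    rw [← Real.log_pow]; exact Real.log_le_log (by positivity) key.le
  have l2 : k * Real.log M ≤ Real.log B := by
    rw [← Real.log_pow]; exact Real.log_le_log (by positivity) (hle.trans hB)
  push_cast at l1
  calc _ ≤ (k : ℝ) * (16 * d ^ 2 * Real.log M) := by gcongr
    _ = 16 * d ^ 2 * (k * Real.log M) := by ring
    _ ≤ _ := by gcongr

noncomputable def auxPoly (n : ℕ) (a : Fin (n + 1) → ℤ) : Polynomial ℤ :=
  ∑ j : Fin (n + 1), Polynomial.C (a j) * Polynomial.X ^ (j : ℕ)

lemma auxPoly_coeff (n : ℕ) (a : Fin (n + 1) → ℤ) (i : ℕ) :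
    (auxPoly n a).coeff i = if h : i < n + 1 then a ⟨i, h⟩ else 0 := by
  simp only [auxPoly, Polynomial.finsetSum_coeff, Polynomial.coeff_C_mul,
    Polynomial.coeff_X_pow, mul_ite, mul_one, mul_zero]
  split_ifs with h
  · rw [Finset.sum_eq_single ⟨i, h⟩]
    · simp
    · intro b _ hb
      rw [if_neg]
      rintro rfl
      exact hb rfl
    · simp
  · refine Finset.sum_eq_zero fun b _ => ?_
    rw [if_neg]
    have := b.2
    omega

lemma auxPoly_map (n : ℕ) (a : Fin (n + 1) → ℤ) :
    (auxPoly n a).map (Int.castRingHom ℂ) = polyOf n a := by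
  simp [auxPoly, polyOf, Polynomial.map_sum]

lemma auxPoly_aeval (n : ℕ) (a : Fin (n + 1) → ℤ) (α : ℂ) :
    Polynomial.aeval α (auxPoly n a) = (polyOf n a).eval α := by
  rw [← auxPoly_map, Polynomial.eval_map, Polynomial.aeval_def]
  rfl

lemma auxPoly_sub (n : ℕ) (a b : Fin (n + 1) → ℤ) :
    auxPoly n (a - b) = auxPoly n a - auxPoly n b := by
  simp [auxPoly, sub_mul]

lemma auxPoly_natDegree (n : ℕ) (a : Fin (n + 1) → ℤ) : (auxPoly n a).natDegree ≤ n := by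
  rw [Polynomial.natDegree_le_iff_coeff_eq_zero]
  intro N hN
  rw [auxPoly_coeff, dif_neg (by omega)]

lemma auxPoly_eq_zero (n : ℕ) (a : Fin (n + 1) → ℤ) (h : auxPoly n a = 0) : a = 0 := by
  funext i
  have := auxPoly_coeff n a i
  rw [h, dif_pos i.2] at this
  simpa using this.symm

open Polynomial in
lemma aux_distinct (n : ℕ) (α : ℂ) (hα : IsIntegral ℤ α) (hα0 : α ≠ 0)
    (hru : ¬ ∃ k : ℕ, 1 ≤ k ∧ α ^ k = 1) (k : ℕ) (hk : k.Prime)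
    (hkd : (minpoly ℚ α).natDegree ^ 2 + 1 < k)
    (hbig : 16 * ((minpoly ℚ α).natDegree : ℝ) ^ 2 * Real.log ((n + 1) * 2) <
      k * Real.log ((minpoly ℚ α).natDegree + 1))
    (a b : Fin (n + 1) → ℤ) (ha : ∀ i, |a i| ≤ 1) (hb : ∀ i, |b i| ≤ 1)
    (hPa : (polyOf n a).eval α = 0) (hPb : (polyOf n b).eval α = 0)
    (hab : ∀ i : Fin (n + 1), ¬ k ∣ (i : ℕ) → a i = b i) : a = b := by
  by_contra hne
  set P := auxPoly n (a - b) with hP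
  have hP0 : P ≠ 0 := fun h => hne (sub_eq_zero.1 (auxPoly_eq_zero n _ h))
  have hroot : aeval α P = 0 := by
    rw [hP, auxPoly_sub, map_sub, auxPoly_aeval, auxPoly_aeval, hPa, hPb, sub_zero]
  set Q := contract k P with hQ
  have hPQ : expand ℤ k Q = P := by
    ext i
    rw [coeff_expand hk.pos, hQ]
    split_ifs with h
    · rw [coeff_contract hk.ne_zero, Nat.div_mul_cancel h]
    · rw [hP, auxPoly_coeff]
      split_ifs with h1
      · simp [hab ⟨i, h1⟩ h]
      · rfl
  have hQ0 : Q ≠ 0 := by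
    intro h; rw [h, map_zero] at hPQ; exact hP0 hPQ.symm
  have hQr : aeval (α ^ k) Q = 0 := by
    rw [← expand_aeval, hPQ, hroot]
  have hcoef : ∀ i, |(P.coeff i : ℝ)| ≤ 2 := by
    intro i
    rw [hP, auxPoly_coeff]
    split_ifs with h
    · have h1 := ha ⟨i, h⟩
      have h2 := hb ⟨i, h⟩
      have : |(a - b) ⟨i, h⟩| ≤ 2 := by
        rw [Pi.sub_apply]; rw [abs_le] at *; omega
      exact_mod_cast this
    · simp
  have hQd : Q.natDegree ≤ n := by
    rw [natDegree_le_iff_coeff_eq_zero]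
    intro N hN
    rw [hQ, coeff_contract hk.ne_zero, hP, auxPoly_coeff, dif_neg]
    nlinarith [hk.pos]
  have hM := aux_mahler_bound Q n 2 hQd
    (fun i => by rw [hQ, coeff_contract hk.ne_zero]; exact hcoef _)
  have := aux_height α hα hα0 hru k hk hkd Q hQ0 hQr _ hM
  linarith

open Polynomial in
lemma aux_minpoly_mahler (n : ℕ) (α : ℂ) (hα : IsIntegral ℤ α) (a : Fin (n + 1) → ℤ)
    (ha : ∀ i, |a i| ≤ 1) (ha0 : a ≠ 0) (hPa : (polyOf n a).eval α = 0) :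
    ((minpoly ℤ α).map (Int.castRingHom ℂ)).mahlerMeasure ≤ n + 1 := by
  have h0 : auxPoly n a ≠ 0 := fun h => ha0 (auxPoly_eq_zero n a h)
  rw [← auxPoly_aeval] at hPa
  obtain ⟨h, hh⟩ := minpoly.isIntegrallyClosed_dvd hα hPa
  have hh0 : h ≠ 0 := by rintro rfl; rw [mul_zero] at hh; exact h0 hh
  have h1 := one_le_mahlerMeasure_of_ne_zero hh0
  have h2 := aux_mahler_bound (auxPoly n a) n 1 (auxPoly_natDegree n a) (by
    intro i
    rw [auxPoly_coeff]
    split_ifs with h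
    · exact_mod_cast ha _
    · simp)
  rw [hh, Polynomial.map_mul, mahlerMeasure_mul, mul_one] at h2
  exact (le_mul_of_one_le_right (mahlerMeasure_nonneg _) h1).trans h2

open Classical in
lemma aux_prob (μ : Measure ℤ) [IsProbabilityMeasure μ]
    (hsupp : μ (({-1, 0, 1} : Set ℤ)ᶜ) = 0) (q : ENNReal)
    (hq : ∀ x ∈ ({-1, 0, 1} : Set ℤ), μ {x} ≤ q) (n : ℕ) (J : Finset (Fin (n + 1)))
    (S : Set (Fin (n + 1) → ℤ))
    (hS : ∀ a ∈ S, ∀ b ∈ S, (∀ i, a i ∈ ({-1, 0, 1} : Set ℤ)) → (∀ i, b i ∈ ({-1, 0, 1} : Set ℤ)) →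
      (∀ i, i ∉ J → a i = b i) → a = b) :
    (Measure.pi fun _ : Fin (n + 1) => μ) S ≤ q ^ J.card := by
  set T : Finset ℤ := {-1, 0, 1} with hT
  have hTm : ∀ x : ℤ, x ∈ T ↔ x ∈ ({-1, 0, 1} : Set ℤ) := by intro x; simp [hT]
  set F : Finset (Fin (n + 1) → ℤ) := (Fintype.piFinset (fun _ => T)).filter (· ∈ S) with hF
  have hFm : ∀ a, a ∈ F ↔ (∀ i, a i ∈ ({-1, 0, 1} : Set ℤ)) ∧ a ∈ S := by
    intro a; rw [hF, Finset.mem_filter, Fintype.mem_piFinset]; simp only [hTm]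
  have hae : ∀ᵐ a ∂(Measure.pi fun _ : Fin (n + 1) => μ), ∀ i, a i ∈ ({-1, 0, 1} : Set ℤ) := by
    rw [Filter.eventually_all]
    intro i
    have : ∀ᵐ x ∂μ, x ∈ ({-1, 0, 1} : Set ℤ) := hsupp
    exact (Measure.tendsto_eval_ae_ae (μ := fun _ : Fin (n + 1) => μ) (i := i)).eventually this
  have h1 : (Measure.pi fun _ : Fin (n + 1) => μ) S ≤
      (Measure.pi fun _ : Fin (n + 1) => μ) (F : Set (Fin (n + 1) → ℤ)) := by
    apply measure_mono_ae
    filter_upwards [hae] with a ha hSa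
    exact (hFm a).2 ⟨ha, hSa⟩
  refine h1.trans ?_
  rw [← sum_measure_singleton]
  simp only [Measure.pi_singleton]
  let v : Fin (n + 1) → ℤ → ENNReal := fun i x => if i ∈ J then 1 else μ {x}
  let r : (Fin (n + 1) → ℤ) → (Fin (n + 1) → ℤ) := fun a i => if i ∈ J then 0 else a i
  let t : Fin (n + 1) → Finset ℤ := fun i => if i ∈ J then {0} else T
  have h2 : ∀ a ∈ F, ∏ i, μ {a i} ≤ q ^ J.card * ∏ i, v i (r a i) := by
    intro a ha
    have e1 : ∏ i, v i (r a i) = ∏ i ∈ Jᶜ, μ {a i} := by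
      rw [← Finset.prod_mul_prod_compl J, Finset.prod_eq_one, one_mul]
      · refine Finset.prod_congr rfl fun i hi => ?_
        have : i ∉ J := Finset.mem_compl.1 hi
        simp [v, r, this]
      · intro i hi; simp [v, hi]
    rw [e1, ← Finset.prod_mul_prod_compl J]
    gcongr
    exact Finset.prod_le_pow_card _ _ _ (fun i _ => hq _ (((hFm a).1 ha).1 i))
  have h3 : ∑ a ∈ F, ∏ i, v i (r a i) ≤ 1 := by
    have hinj : Set.InjOn r F := by
      intro a ha b hb hab
      have ha' := (hFm a).1 ha
      have hb' := (hFm b).1 hb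
      refine hS a ha'.2 b hb'.2 ha'.1 hb'.1 fun i hi => ?_
      have := congrFun hab i
      simpa [r, hi] using this
    rw [← Finset.sum_image (f := fun b => ∏ i, v i (b i)) hinj]
    calc _ ≤ ∑ b ∈ Fintype.piFinset t, ∏ i, v i (b i) := by
          apply Finset.sum_le_sum_of_subset
          intro b hb
          obtain ⟨a, ha, rfl⟩ := Finset.mem_image.1 hb
          rw [Fintype.mem_piFinset]
          intro i
          by_cases hi : i ∈ J
          · simp [r, t, hi]
          · simp only [r, t, hi, if_false]
            exact (hTm _).2 (((hFm a).1 ha).1 i)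
      _ = ∏ i, ∑ x ∈ t i, v i x := (Finset.prod_univ_sum t v).symm
      _ ≤ 1 := by
          refine Finset.prod_le_one' fun i _ => ?_
          by_cases hi : i ∈ J
          · simp [t, v, hi]
          · simp only [t, v, hi, if_false]
            rw [sum_measure_singleton]
            exact prob_le_one
  calc _ ≤ ∑ a ∈ F, q ^ J.card * ∏ i, v i (r a i) := Finset.sum_le_sum h2
    _ = q ^ J.card * ∑ a ∈ F, ∏ i, v i (r a i) := by rw [Finset.mul_sum]
    _ ≤ q ^ J.card * 1 := by gcongr
    _ = _ := mul_one _

lemma aux_T {x : ℤ} (hx : x ∈ ({-1, 0, 1} : Set ℤ)) : |x| ≤ 1 := by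
  rcases hx with rfl | rfl | rfl <;> simp

lemma aux_natDegree (α : ℂ) (hα : IsIntegral ℤ α) :
    (minpoly ℤ α).natDegree = (minpoly ℚ α).natDegree := by
  rw [minpoly.isIntegrallyClosed_eq_field_fractions' ℚ hα, (minpoly.monic hα).natDegree_map]

open Polynomial in
lemma aux_main (μ : Measure ℤ) [IsProbabilityMeasure μ]
    (hsupp : μ (({-1, 0, 1} : Set ℤ)ᶜ) = 0) (q : ENNReal)
    (hq : ∀ x ∈ ({-1, 0, 1} : Set ℤ), μ {x} ≤ q) (n D k : ℕ) (hn : 1 ≤ n) (hD : 1 ≤ D)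
    (hk : k.Prime) (hkD : D ^ 2 + 1 < k)
    (hbig : ∀ d : ℕ, 1 ≤ d → d ≤ D →
      16 * (d : ℝ) ^ 2 * Real.log ((n + 1) * 2) < k * Real.log (d + 1)) :
    (Measure.pi fun _ : Fin (n + 1) => μ)
          {a | ∃ α : ℂ, (polyOf n a).eval α = 0 ∧ α ≠ 0 ∧ IsIntegral ℤ α ∧
                (minpoly ℚ α).natDegree ≤ D ∧
                ¬ ∃ k : ℕ, 1 ≤ k ∧ α ^ k = 1} ≤
      ((∏ i : Fin (D + 1), (2 * ⌊(D.choose i : NNReal) * ((n : NNReal) + 1)⌋₊ + 1) : ℕ) : ENNReal)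
        * q ^ (n / k) := by
  classical
  set P := (Measure.pi fun _ : Fin (n + 1) => μ) with hP
  have hfin := finite_mahlerMeasure_le D ((n : NNReal) + 1)
  have hcard := card_mahlerMeasure_le_prod D ((n : NNReal) + 1)
  set G := {p : ℤ[X] | p.natDegree ≤ D ∧
    (p.map (Int.castRingHom ℂ)).mahlerMeasure ≤ (((n : NNReal) + 1 : NNReal) : ℝ)} with hG
  let E : ℤ[X] → Set (Fin (n + 1) → ℤ) := fun f =>
    {a | ∃ α : ℂ, minpoly ℤ α = f ∧ (polyOf n a).eval α = 0 ∧ α ≠ 0 ∧ IsIntegral ℤ α ∧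
      (minpoly ℚ α).natDegree ≤ D ∧ ¬ ∃ k : ℕ, 1 ≤ k ∧ α ^ k = 1}
  have hae : ∀ᵐ a ∂P, ∀ i, a i ∈ ({-1, 0, 1} : Set ℤ) := by
    rw [Filter.eventually_all]
    intro i
    have : ∀ᵐ x ∂μ, x ∈ ({-1, 0, 1} : Set ℤ) := hsupp
    exact (Measure.tendsto_eval_ae_ae (μ := fun _ : Fin (n + 1) => μ) (i := i)).eventually this
  have hE : ∀ f, P (E f) ≤ q ^ (n / k) := by
    intro f
    have hlt : ∀ i : Fin (n / k), (i : ℕ) * k < n + 1 := fun i => by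
      have h1 : (i : ℕ) * k ≤ (n / k) * k := Nat.mul_le_mul_right _ i.2.le
      have h2 := Nat.div_mul_le_self n k
      omega
    let g : Fin (n / k) → Fin (n + 1) := fun i => ⟨i * k, hlt i⟩
    have hg : Function.Injective g := by
      intro i j hij
      have : (i : ℕ) * k = j * k := congrArg Fin.val hij
      exact Fin.ext (Nat.eq_of_mul_eq_mul_right hk.pos this)
    have hJ : (Finset.univ.image g).card = n / k := by
      rw [Finset.card_image_of_injective _ hg]; simp
    rw [← hJ]
    refine aux_prob μ hsupp q hq n _ _ ?_
    rintro a ⟨α, hαf, hPa, hα0, hαi, hαd, hru⟩ b ⟨β, hβf, hPb, -, hβi, -, -⟩ ha hb hab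
    have hPb' : (polyOf n b).eval α = 0 := by
      rw [← auxPoly_aeval] at hPb ⊢
      have := minpoly.isIntegrallyClosed_dvd hβi hPb
      rw [hβf, ← hαf] at this
      exact aeval_eq_zero_of_dvd_aeval_eq_zero this (minpoly.aeval _ _)
    refine aux_distinct n α hαi hα0 hru k hk ?_ (hbig _ ?_ hαd) a b (fun i => aux_T (ha i))
      (fun i => aux_T (hb i)) hPa hPb' ?_
    · have := Nat.pow_le_pow_left hαd 2
      omega
    · exact minpoly.natDegree_pos hαi.tower_top
    · intro i hi
      apply hab
      intro hmem
      obtain ⟨j, _, rfl⟩ := Finset.mem_image.1 hmem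
      exact hi (Dvd.intro_left _ rfl)
  have hsub : P {a | ∃ α : ℂ, (polyOf n a).eval α = 0 ∧ α ≠ 0 ∧ IsIntegral ℤ α ∧
                (minpoly ℚ α).natDegree ≤ D ∧
                ¬ ∃ k : ℕ, 1 ≤ k ∧ α ^ k = 1} ≤ P (⋃ f ∈ hfin.toFinset, E f) := by
    apply measure_mono_ae
    filter_upwards [hae] with a ha hSa
    obtain ⟨α, hPa, hα0, hαi, hαd, hru⟩ := hSa
    by_cases ha0 : a = 0
    · have h2i : IsIntegral ℤ (2 : ℂ) := by
        simpa using (isIntegral_algebraMap (R := ℤ) (A := ℂ) (x := 2))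
      have hmin : minpoly ℤ (2 : ℂ) = X - C 2 := by
        have := minpoly.eq_X_sub_C_of_algebraMap_inj (A := ℤ) (B := ℂ) 2
          (by simpa using (Int.cast_injective (α := ℂ)))
        simpa using this
      refine Set.mem_iUnion₂.2 ⟨X - C 2, ?_, 2, hmin, ?_, two_ne_zero, h2i, ?_, ?_⟩
      · rw [Set.Finite.mem_toFinset]
        refine ⟨by rw [natDegree_X_sub_C]; exact hD, ?_⟩
        rw [Polynomial.map_sub, map_X, map_C, mahlerMeasure_X_sub_C]
        have : (1 : ℝ) ≤ n := by exact_mod_cast hn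
        simp
        linarith
      · subst ha0
        simp [polyOf]
      · rw [← aux_natDegree _ h2i, hmin, natDegree_X_sub_C]; exact hD
      · rintro ⟨j, hj, h⟩
        have h' : (2 : ℕ) ^ j = 1 := by exact_mod_cast h
        have := Nat.one_lt_two_pow (n := j) (by omega)
        omega
    · refine Set.mem_iUnion₂.2 ⟨minpoly ℤ α, ?_, α, rfl, hPa, hα0, hαi, hαd, hru⟩
      rw [Set.Finite.mem_toFinset]
      refine ⟨by rw [aux_natDegree _ hαi]; exact hαd, ?_⟩
      have := aux_minpoly_mahler n α hαi a (fun i => aux_T (ha i)) ha0 hPa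
      simpa using this
  calc _ ≤ P (⋃ f ∈ hfin.toFinset, E f) := hsub
    _ ≤ ∑ f ∈ hfin.toFinset, P (E f) := measure_biUnion_finset_le _ _
    _ ≤ ∑ f ∈ hfin.toFinset, q ^ (n / k) := Finset.sum_le_sum fun f _ => hE f
    _ = (hfin.toFinset.card : ENNReal) * q ^ (n / k) := by rw [Finset.sum_const, nsmul_eq_mul]
    _ ≤ _ := by
      gcongr
      rw [← Set.ncard_eq_toFinset_card G hfin]
      exact hcard

lemma aux_count (n D : ℕ) (hn : 1 ≤ n) :
    ((∏ i : Fin (D + 1), (2 * ⌊(D.choose i : NNReal) * ((n : NNReal) + 1)⌋₊ + 1) : ℕ) : ℝ) ≤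
      Real.exp ((D + 1) * (D + Real.log n + 2)) := by
  have hn' : (1 : ℝ) ≤ n := by exact_mod_cast hn
  have he : (2.7 : ℝ) ≤ Real.exp 1 := by have := Real.exp_one_gt_d9; linarith
  have hfac : ∀ i : Fin (D + 1),
      ((2 * ⌊(D.choose i : NNReal) * ((n : NNReal) + 1)⌋₊ + 1 : ℕ) : ℝ) ≤
        Real.exp (D + Real.log n + 2) := by
    intro i
    have h1 : ⌊(D.choose i : NNReal) * ((n : NNReal) + 1)⌋₊ = D.choose i * (n + 1) := by
      have : (D.choose i : NNReal) * ((n : NNReal) + 1) = ((D.choose i * (n + 1) : ℕ) : NNReal) := by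
        push_cast; rfl
      rw [this, Nat.floor_natCast]
    rw [h1]
    have h2 : ((D.choose i : ℕ) : ℝ) ≤ 2 ^ D := by exact_mod_cast Nat.choose_le_two_pow D i
    have h3 : (2 : ℝ) ^ D ≤ Real.exp D := by
      rw [← Real.exp_one_pow]
      exact pow_le_pow_left₀ (by norm_num) (by linarith) _
    have h4 : (1 : ℝ) ≤ Real.exp D := Real.one_le_exp (by positivity)
    rw [Real.exp_add, Real.exp_add, Real.exp_log (by linarith)]
    have h5 : (6 : ℝ) ≤ Real.exp 2 := by
      have : Real.exp 2 = Real.exp 1 * Real.exp 1 := by rw [← Real.exp_add]; norm_num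
      rw [this]; nlinarith
    push_cast
    have h6 : ((D.choose i : ℕ) : ℝ) * (n + 1) ≤ Real.exp D * (2 * n) := by
      apply mul_le_mul (h2.trans h3) (by linarith) (by positivity) (by positivity)
    have h7 : 1 ≤ Real.exp D * n := one_le_mul_of_one_le_of_one_le h4 hn'
    have h8 : Real.exp D * n * 6 ≤ Real.exp D * n * Real.exp 2 := by gcongr
    linarith
  rw [Nat.cast_prod]
  calc _ ≤ ∏ i : Fin (D + 1), Real.exp (D + Real.log n + 2) :=
        Finset.prod_le_prod (fun i _ => by positivity) (fun i _ => hfac i)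
    _ = _ := by
      rw [Finset.prod_const, Finset.card_univ, Fintype.card_fin, ← Real.exp_nat_mul]
      push_cast; rfl

lemma aux_eventually (A : ℝ) (hA : 0 < A) : ∀ᶠ L : ℝ in Filter.atTop,
    2 ≤ L ∧ 1 ≤ A * L ∧ (A * L) ^ 2 + 1 < L ^ 3 / 8 ∧
    32 * Real.exp (256 * A ^ 2 + 1) < L ∧
    ((A + 1) * (A + 3) + 1) * L ^ 5 ≤ Real.exp L := by
  filter_upwards [Filter.eventually_ge_atTop 2, Filter.eventually_ge_atTop (1 / A),
    Filter.eventually_gt_atTop (8 * (A ^ 2 + 1)),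
    Filter.eventually_gt_atTop (32 * Real.exp (256 * A ^ 2 + 1)),
    (Real.tendsto_exp_div_pow_atTop 5).eventually_ge_atTop ((A + 1) * (A + 3) + 1)]
    with L h1 h2 h3 h4 h5
  refine ⟨h1, ?_, ?_, h4, ?_⟩
  · rw [div_le_iff₀ hA] at h2; linarith
  · have : 1 ≤ L ^ 2 := by nlinarith
    have : 8 * (A ^ 2 + 1) * L ^ 2 < L * L ^ 2 := by gcongr
    nlinarith
  · rwa [le_div_iff₀ (by positivity)] at h5

theorem non_root_of_unity_roots_rare (μ : MeasureTheory.Measure ℤ) [IsProbabilityMeasure μ]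
    (hsupp : μ (({-1, 0, 1} : Set ℤ)ᶜ) = 0)
    (hC : ∀ x ∈ ({-1, 0, 1} : Set ℤ), (μ {x}).toReal < 1 / Real.sqrt 3) :
    ∀ A : ℝ, 0 < A → ∃ n₀ : ℕ, ∀ n : ℕ, n₀ ≤ n →
      ((Measure.pi fun _ : Fin (n + 1) => μ)
          {a | ∃ α : ℂ, (polyOf n a).eval α = 0 ∧ α ≠ 0 ∧ IsIntegral ℤ α ∧
                (((minpoly ℚ α).natDegree : ℝ) ≤ A * Real.log n) ∧
                ¬ ∃ k : ℕ, 1 ≤ k ∧ α ^ k = 1}).toReal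
        ≤ Real.exp (-(n : ℝ) / Real.log n ^ 3) := by
  intro A hA
  have hev := (Real.tendsto_log_atTop.comp (tendsto_natCast_atTop_atTop (R := ℝ))).eventually
    (aux_eventually A hA)
  obtain ⟨n₀, hn₀⟩ := Filter.eventually_atTop.1 hev
  refine ⟨max n₀ 3, fun n hn => ?_⟩
  obtain ⟨hL2, hAL, hi, hii, hiii⟩ := hn₀ n ((le_max_left _ _).trans hn)
  have hn3 : 3 ≤ n := (le_max_right _ _).trans hn
  simp only [Function.comp_apply] at hL2 hAL hi hii hiii
  have hn3' : (3 : ℝ) ≤ n := by exact_mod_cast hn3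
  rw [Real.exp_log (by linarith)] at hiii
  set L := Real.log n with hL
  set D := ⌊A * L⌋₊ with hDdef
  have hDle : (D : ℝ) ≤ A * L := Nat.floor_le (by linarith)
  have hD1 : 1 ≤ D := by rw [hDdef, Nat.one_le_floor_iff]; exact hAL
  have hL8 : 1 ≤ L ^ 3 / 8 := by
    have : (2 : ℝ) ^ 3 ≤ L ^ 3 := by gcongr
    linarith
  obtain ⟨k, hk, hk1, hk2⟩ := Nat.exists_prime_lt_and_le_two_mul ⌊L ^ 3 / 8⌋₊
    (by have := (Nat.one_le_floor_iff _).2 hL8; omega)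
  have hkL : L ^ 3 / 8 < k := (Nat.floor_lt (by linarith)).1 hk1
  have hkU : (k : ℝ) ≤ L ^ 3 / 4 := by
    have h1 : (⌊L ^ 3 / 8⌋₊ : ℝ) ≤ L ^ 3 / 8 := Nat.floor_le (by linarith)
    have h2 : (k : ℝ) ≤ 2 * ⌊L ^ 3 / 8⌋₊ := by exact_mod_cast hk2
    linarith
  have hkD : D ^ 2 + 1 < k := by
    have : (D : ℝ) ^ 2 + 1 < k := by
      have : (D : ℝ) ^ 2 ≤ (A * L) ^ 2 := by gcongr
      linarith
    exact_mod_cast this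
  have hlog : Real.log ((n + 1) * 2) ≤ 2 * L := by
    rw [hL, ← Real.log_rpow (by linarith)]
    apply Real.log_le_log (by linarith)
    norm_cast
    nlinarith
  have hbig : ∀ d : ℕ, 1 ≤ d → d ≤ D →
      16 * (d : ℝ) ^ 2 * Real.log ((n + 1) * 2) < k * Real.log (d + 1) := by
    intro d hd1 hdD
    have hd1' : (1 : ℝ) ≤ d := by exact_mod_cast hd1
    have hdD' : (d : ℝ) ≤ A * L := le_trans (by exact_mod_cast hdD) hDle
    have hlogd : 1 / 2 < Real.log (d + 1) := by
      have h1 : Real.log 2 ≤ Real.log (d + 1) := Real.log_le_log (by norm_num) (by linarith)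
      have := Real.log_two_gt_d9
      linarith
    have hmain : 256 * (d : ℝ) ^ 2 < L ^ 2 * Real.log (d + 1) := by
      rcases le_or_gt (256 * A ^ 2 + 1) (Real.log (d + 1)) with hc | hc
      · have h1 : (d : ℝ) ^ 2 ≤ (A * L) ^ 2 := by gcongr
        have h2 : L ^ 2 * (256 * A ^ 2 + 1) ≤ L ^ 2 * Real.log (d + 1) := by gcongr
        have h3 : 0 < L ^ 2 := by positivity
        nlinarith
      · have h1 : (d : ℝ) + 1 < Real.exp (256 * A ^ 2 + 1) := by
          rwa [← Real.log_lt_iff_lt_exp (by linarith)]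
        have h2 : 32 * (d : ℝ) < L := by linarith
        have h3 : (32 * (d : ℝ)) ^ 2 < L ^ 2 := by gcongr
        nlinarith
    calc 16 * (d : ℝ) ^ 2 * Real.log ((n + 1) * 2) ≤ 16 * (d : ℝ) ^ 2 * (2 * L) := by gcongr
      _ = (256 * (d : ℝ) ^ 2) * (L / 8) := by ring
      _ < (L ^ 2 * Real.log (d + 1)) * (L / 8) := by gcongr
      _ = L ^ 3 / 8 * Real.log (d + 1) := by ring
      _ ≤ _ := by gcongr
  have hs3 : 0 < Real.sqrt 3 := by positivity
  set q : ENNReal := ENNReal.ofReal (1 / Real.sqrt 3) with hq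
  have hqx : ∀ x ∈ ({-1, 0, 1} : Set ℤ), μ {x} ≤ q := fun x hx =>
    (ENNReal.le_ofReal_iff_toReal_le (measure_ne_top _ _) (by positivity)).2 (hC x hx).le
  have hbound := aux_main μ hsupp q hqx n D k (by omega) hD1 hk hkD hbig
  have hset : {a : Fin (n + 1) → ℤ | ∃ α : ℂ, (polyOf n a).eval α = 0 ∧ α ≠ 0 ∧ IsIntegral ℤ α ∧
                (((minpoly ℚ α).natDegree : ℝ) ≤ A * L) ∧
                ¬ ∃ k : ℕ, 1 ≤ k ∧ α ^ k = 1} =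
      {a | ∃ α : ℂ, (polyOf n a).eval α = 0 ∧ α ≠ 0 ∧ IsIntegral ℤ α ∧
                (minpoly ℚ α).natDegree ≤ D ∧ ¬ ∃ k : ℕ, 1 ≤ k ∧ α ^ k = 1} := by
    ext a
    simp only [Set.mem_ofPred_eq, hDdef, Nat.le_floor_iff (show 0 ≤ A * L by linarith)]
  rw [hset]
  have hcount := aux_count n D (by omega)
  set N := ∏ i : Fin (D + 1), (2 * ⌊(D.choose i : NNReal) * ((n : NNReal) + 1)⌋₊ + 1) with hN
  have h1 := ENNReal.toReal_mono (ENNReal.mul_ne_top (ENNReal.natCast_ne_top N)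
    (ENNReal.pow_ne_top ENNReal.ofReal_ne_top)) hbound
  refine h1.trans ?_
  rw [ENNReal.toReal_mul, ENNReal.toReal_pow, ENNReal.toReal_natCast,
    ENNReal.toReal_ofReal (by positivity)]
  have hqe : 1 / Real.sqrt 3 ≤ Real.exp (-(1 / 2)) := by
    rw [Real.exp_neg, one_div]
    apply inv_anti₀ (Real.exp_pos _)
    apply Real.le_sqrt_of_sq_le
    rw [← Real.exp_nat_mul]
    have := Real.exp_one_lt_d9
    norm_num
    linarith
  have hkpos : (0 : ℝ) < k := by exact_mod_cast hk.pos
  have hfl : (n : ℝ) / k - 1 ≤ ((n / k : ℕ) : ℝ) := by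
    have := Nat.lt_floor_add_one ((n : ℝ) / k)
    rw [Nat.floor_div_eq_div] at this
    linarith
  have hpow : (1 / Real.sqrt 3) ^ (n / k) ≤ Real.exp (1 / 2 - 2 * n / L ^ 3) := by
    calc (1 / Real.sqrt 3) ^ (n / k) ≤ (Real.exp (-(1 / 2))) ^ (n / k) := by gcongr
      _ = Real.exp (((n / k : ℕ) : ℝ) * (-(1 / 2))) := by rw [← Real.exp_nat_mul]
      _ ≤ _ := by
        apply Real.exp_le_exp.2
        have h5 : 4 * n / L ^ 3 ≤ (n : ℝ) / k := by
          rw [div_le_div_iff₀ (by positivity) hkpos]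
          nlinarith
        have h6 : 4 * n / L ^ 3 = 2 * (2 * n / L ^ 3) := by ring
        linarith
  calc (N : ℝ) * (1 / Real.sqrt 3) ^ (n / k)
      ≤ Real.exp ((D + 1) * (D + L + 2)) * Real.exp (1 / 2 - 2 * n / L ^ 3) := by gcongr
    _ = Real.exp ((D + 1) * (D + L + 2) + (1 / 2 - 2 * n / L ^ 3)) := by rw [Real.exp_add]
    _ ≤ _ := by
      apply Real.exp_le_exp.2
      have h5 : ((D : ℝ) + 1) * (D + L + 2) ≤ (A * L + L) * (A * L + L + 2 * L) := by
        gcongr <;> linarith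
      have h6 : ((A + 1) * (A + 3) + 1) * L ^ 2 ≤ n / L ^ 3 := by
        rw [le_div_iff₀ (by positivity)]
        calc _ = ((A + 1) * (A + 3) + 1) * L ^ 5 := by ring
          _ ≤ _ := hiii
      have h7 : 2 * (n : ℝ) / L ^ 3 = 2 * (n / L ^ 3) := by ring
      have h8 : -(n : ℝ) / L ^ 3 = - (n / L ^ 3) := by ring
      rw [h7, h8]
      nlinarith
end

section
/- Assume condition (C). Then as n → ∞, n² · P( P_n has a double root α ∈ ℂ with α a root of unity and α ∉ {−1, 1} ) → 0; that is, the probability that some root of unity other than ±1 is a double root of P_n is o(n^{−2}). -/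
open Filter MeasureTheory

/-- `z` is a double root of the polynomial with coefficients `a`. -/
def isDoubleRootAt (n : ℕ) (a : Fin (n + 1) → ℤ) (z : ℂ) : Prop :=
  (polyOf n a).eval z = 0 ∧ (Polynomial.derivative (polyOf n a)).eval z = 0

theorem mp_extend {A ι : Type*} [Fintype A] [Fintype ι] (μ : Measure ℤ) [IsProbabilityMeasure μ]
    (f : A → ι) (hf : Function.Injective f) :
    Measure.map (fun p : (A → ℤ) × (ι → ℤ) => Function.extend f p.1 p.2)
      ((Measure.pi fun _ : A => μ).prod (Measure.pi fun _ : ι => μ)) = Measure.pi fun _ : ι => μ := by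
  classical
  symm
  apply Measure.pi_eq
  intro s hs
  rw [Measure.map_apply (measurable_of_countable _) (MeasurableSet.of_discrete)]
  have : (fun p : (A → ℤ) × (ι → ℤ) => Function.extend f p.1 p.2) ⁻¹' (Set.univ.pi s)
      = (Set.univ.pi fun a => s (f a)) ×ˢ
        (Set.univ.pi fun j => if j ∈ Set.range f then Set.univ else s j) := by
    ext ⟨x, b⟩
    simp only [Set.mem_preimage, Set.mem_pi, Set.mem_univ, true_imp_iff, Set.mem_prod]
    constructor
    · intro h
      refine ⟨fun a => ?_, fun j => ?_⟩
      · simpa [hf.extend_apply] using h (f a)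
      · split_ifs with hj
        · trivial
        · have := h j
          rwa [Function.extend_apply' _ _ _ (by simpa using hj)] at this
    · rintro ⟨h1, h2⟩ j
      by_cases hj : j ∈ Set.range f
      · obtain ⟨a, rfl⟩ := hj
        simpa [hf.extend_apply] using h1 a
      · have := h2 j
        rw [if_neg hj] at this
        rwa [Function.extend_apply' _ _ _ (by simpa using hj)]
  rw [this, Measure.prod_prod, Measure.pi_pi, Measure.pi_pi]
  have h1 : ∏ a, μ (s (f a)) = ∏ j, if j ∈ Set.range f then μ (s j) else 1 := by
    apply Fintype.prod_of_injective f hf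
    · intro j hj; simp only [if_neg hj]
    · intro a; simp
  rw [h1, ← Finset.prod_mul_distrib]
  refine Finset.prod_congr rfl fun j _ => ?_
  split_ifs <;> simp

theorem le_of_sections {A ι : Type*} [Fintype A] [Fintype ι] (μ : Measure ℤ)
    [IsProbabilityMeasure μ]
    (f : A → ι) (hf : Function.Injective f) (E : Set (ι → ℤ)) (C : ENNReal)
    (h : ∀ b, (Measure.pi fun _ : A => μ) {x | Function.extend f x b ∈ E} ≤ C) :
    (Measure.pi fun _ : ι => μ) E ≤ C := by
  rw [← mp_extend μ f hf,
    Measure.map_apply (measurable_of_countable _) (MeasurableSet.of_discrete),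
    Measure.prod_apply_symm (MeasurableSet.of_discrete)]
  calc _ ≤ ∫⁻ _, C ∂(Measure.pi fun _ : ι => μ) := lintegral_mono fun b => h b
    _ = C := by simp

theorem sum_extend_sub {A ι : Type*} [Fintype A] [Fintype ι] (f : A → ι)
    (hf : Function.Injective f) (x x' : A → ℤ) (b : ι → ℤ) (g : ι → ℂ) :
    ∑ j, ((Function.extend f x b j : ℤ) : ℂ) * g j - ∑ j, ((Function.extend f x' b j : ℤ) : ℂ) * g j
      = ∑ i, ((x i - x' i : ℤ) : ℂ) * g (f i) := by
  classical
  rw [← Finset.sum_sub_distrib]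
  symm
  apply Fintype.sum_of_injective f hf
  · intro j hj
    have : ¬ ∃ a, f a = j := by simpa using hj
    simp [Function.extend_apply' _ _ _ this]
  · intro i
    simp [hf.extend_apply, sub_mul]

theorem totient_lb (k : ℕ) : k ≤ 2 * k.totient ^ 2 ∧ (Odd k → k ≤ k.totient ^ 2) := by
  induction k using Nat.recOnPosPrimePosCoprime with
  | prime_pow p a hp ha =>
    obtain ⟨a, rfl⟩ : ∃ b, a = b + 1 := ⟨a - 1, by omega⟩
    rw [Nat.totient_prime_pow_succ hp]
    have h1 : 1 ≤ p ^ a := Nat.one_le_pow _ _ hp.pos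
    obtain ⟨r, rfl⟩ : ∃ r, p = r + 2 := ⟨p - 2, by have := hp.two_le; omega⟩
    have e : r + 2 - 1 = r + 1 := by omega
    rw [e]
    constructor
    · have h2 : r + 2 ≤ 2 * (r + 1) ^ 2 := by nlinarith
      have h3 : (r + 2) ^ a ≤ ((r + 2) ^ a) ^ 2 := by nlinarith
      calc (r + 2) ^ (a + 1) = (r + 2) ^ a * (r + 2) := pow_succ _ _
        _ ≤ ((r + 2) ^ a) ^ 2 * (2 * (r + 1) ^ 2) := Nat.mul_le_mul h3 h2
        _ = _ := by ring
    · intro ho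
      have hr : 1 ≤ r := by
        rcases Nat.eq_zero_or_pos r with h | h
        · subst h; rw [pow_succ, Nat.odd_mul] at ho; exact absurd ho.2 (by decide)
        · exact h
      have h2 : r + 2 ≤ (r + 1) ^ 2 := by nlinarith
      have h3 : (r + 2) ^ a ≤ ((r + 2) ^ a) ^ 2 := by nlinarith
      calc (r + 2) ^ (a + 1) = (r + 2) ^ a * (r + 2) := pow_succ _ _
        _ ≤ ((r + 2) ^ a) ^ 2 * ((r + 1) ^ 2) := Nat.mul_le_mul h3 h2
        _ = _ := by ring
  | zero => simp
  | one => simp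
  | coprime a b ha hb hab iha ihb =>
    rw [Nat.totient_mul hab, mul_pow]
    constructor
    · rcases Nat.even_or_odd a with h | h
      · have hb' : Odd b := by
          rw [← Nat.not_even_iff_odd]; intro h'
          have := Nat.dvd_gcd h.two_dvd h'.two_dvd
          rw [hab] at this; omega
        calc _ ≤ (2 * a.totient ^ 2) * (b.totient ^ 2) := Nat.mul_le_mul iha.1 (ihb.2 hb')
          _ = _ := by ring
      · calc _ ≤ (a.totient ^ 2) * (2 * b.totient ^ 2) := Nat.mul_le_mul (iha.2 h) ihb.1
          _ = _ := by ring
    · intro h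
      rw [Nat.odd_mul] at h
      exact Nat.mul_le_mul (iha.2 h.1) (ihb.2 h.2)

/-- z ≠ 1, z^q = 1 is separated from one -/
theorem sep_root (z : ℂ) (q : ℕ) (hz : z ^ q = 1) (h1 : z ≠ 1) (hn : ‖z‖ = 1)
    (hq : 0 < q) : 2 ≤ q * ‖z - 1‖ := by
  have hs : ∑ i ∈ Finset.range q, z ^ i = 0 := by
    have := geom_sum_mul z q
    rw [hz, sub_self] at this
    exact (mul_eq_zero.mp this).resolve_right (sub_ne_zero.mpr h1)
  have hb : ∀ i : ℕ, ‖z ^ i - 1‖ ≤ i * ‖z - 1‖ := by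
    intro i
    rw [← geom_sum_mul, norm_mul]
    gcongr
    calc _ ≤ ∑ j ∈ Finset.range i, ‖z ^ j‖ := norm_sum_le _ _
      _ = i := by simp [hn]
  have h2 : (q : ℝ) ≤ ∑ i ∈ Finset.range q, (i : ℝ) * ‖z - 1‖ := by
    calc (q : ℝ) = ‖∑ i ∈ Finset.range q, (z ^ i - 1)‖ := by
          rw [Finset.sum_sub_distrib, hs]; simp
      _ ≤ ∑ i ∈ Finset.range q, ‖z ^ i - 1‖ := norm_sum_le _ _
      _ ≤ _ := Finset.sum_le_sum fun i _ => hb i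
  rw [← Finset.sum_mul] at h2
  have h3 : (∑ i ∈ Finset.range q, (i : ℝ)) * 2 ≤ (q : ℝ) * (q : ℝ) := by
    have := Finset.sum_range_id_mul_two q
    have h4 : (∑ i ∈ Finset.range q, i) * 2 ≤ q * q := by
      rw [this]; exact Nat.mul_le_mul_left _ (Nat.sub_le _ _)
    have h6 : (((∑ i ∈ Finset.range q, i) * 2 : ℕ) : ℝ) ≤ ((q * q : ℕ) : ℝ) := Nat.cast_le.mpr h4
    push_cast at h6; exact h6
  have hq' : (0 : ℝ) < q := by positivity
  have h5 : (q : ℝ) * 2 ≤ q * (q * ‖z - 1‖) := by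
    nlinarith [norm_nonneg (z - 1)]
  exact le_of_mul_le_mul_left h5 hq'
theorem sum_lb (z : ℂ) (q m : ℕ) (hq : 0 < q) (hm : 2 * q ^ 2 ≤ m) (hz : z ^ (q ^ 3) = 1)
    (h1 : z ≠ 1) (hn : ‖z‖ = 1) :
    (m : ℝ) / (2 * q ^ 2) ≤ ∑ i ∈ Finset.range m, ‖z ^ i - 1‖ ^ 2 := by
  obtain ⟨l, hl, hs⟩ : ∃ l, l ≤ q ^ 2 ∧ 2 ≤ q * ‖z ^ l - 1‖ := by
    by_cases ha : z ^ (q ^ 2) = 1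
    · by_cases hb : z ^ q = 1
      · exact ⟨1, Nat.one_le_pow _ _ hq, by simpa using sep_root z q hb h1 hn hq⟩
      · exact ⟨q, by nlinarith, sep_root _ q (by rw [← pow_mul, ← ha]; ring_nf) hb (by simp [hn]) hq⟩
    · exact ⟨q ^ 2, le_rfl, sep_root _ q (by rw [← pow_mul, ← hz]; ring_nf) ha (by simp [hn]) hq⟩
  have hq' : (0 : ℝ) < q := by positivity
  have hpt : ∀ i : ℕ, ‖z ^ l - 1‖ ^ 2 ≤ 2 * (‖z ^ i - 1‖ ^ 2 + ‖z ^ (i + l) - 1‖ ^ 2) := by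
    intro i
    have e : ‖z ^ l - 1‖ = ‖(z ^ (i + l) - 1) - (z ^ i - 1)‖ := by
      have : (z ^ (i + l) - 1) - (z ^ i - 1) = z ^ i * (z ^ l - 1) := by ring
      rw [this, norm_mul, norm_pow, hn, one_pow, one_mul]
    have := norm_sub_le (z ^ (i + l) - 1) (z ^ i - 1)
    rw [← e] at this
    have h0 := norm_nonneg (z ^ l - 1)
    nlinarith [sq_nonneg (‖z ^ (i + l) - 1‖ - ‖z ^ i - 1‖)]
  have hlm : l ≤ m := by nlinarith
  have hA : ∑ i ∈ Finset.range (m - l), ‖z ^ i - 1‖ ^ 2 ≤ ∑ i ∈ Finset.range m, ‖z ^ i - 1‖ ^ 2 :=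
    Finset.sum_le_sum_of_subset_of_nonneg (Finset.range_mono (Nat.sub_le _ _))
      (fun _ _ _ => by positivity)
  have hB : ∑ i ∈ Finset.range (m - l), ‖z ^ (i + l) - 1‖ ^ 2
      ≤ ∑ i ∈ Finset.range m, ‖z ^ i - 1‖ ^ 2 := by
    have : m = l + (m - l) := by omega
    conv_rhs => rw [this, Finset.sum_range_add]
    simp only [add_comm l]
    have : 0 ≤ ∑ i ∈ Finset.range l, ‖z ^ i - 1‖ ^ 2 := Finset.sum_nonneg fun _ _ => by positivity
    linarith
  have hC : ((m - l : ℕ) : ℝ) * ‖z ^ l - 1‖ ^ 2 ≤ 4 * ∑ i ∈ Finset.range m, ‖z ^ i - 1‖ ^ 2 := by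
    calc ((m - l : ℕ) : ℝ) * ‖z ^ l - 1‖ ^ 2 = ∑ i ∈ Finset.range (m - l), ‖z ^ l - 1‖ ^ 2 := by simp
      _ ≤ ∑ i ∈ Finset.range (m - l), 2 * (‖z ^ i - 1‖ ^ 2 + ‖z ^ (i + l) - 1‖ ^ 2) :=
        Finset.sum_le_sum fun i _ => hpt i
      _ ≤ _ := by rw [← Finset.mul_sum, Finset.sum_add_distrib]; linarith
  have hD : (m : ℝ) / 2 ≤ ((m - l : ℕ) : ℝ) := by
    rw [Nat.cast_sub hlm]
    have : (2 * l : ℝ) ≤ m := by exact_mod_cast (by omega : 2 * l ≤ m)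
    linarith
  have hE : 4 ≤ (q : ℝ) ^ 2 * ‖z ^ l - 1‖ ^ 2 := by
    nlinarith
  rw [div_le_iff₀ (by positivity)]
  have h6 : (m : ℝ) / 2 * ‖z ^ l - 1‖ ^ 2 ≤ 4 * ∑ i ∈ Finset.range m, ‖z ^ i - 1‖ ^ 2 :=
    (mul_le_mul_of_nonneg_right hD (by positivity)).trans hC
  have h7 : (m : ℝ) / 2 * 4 ≤ (m : ℝ) / 2 * ((q : ℝ) ^ 2 * ‖z ^ l - 1‖ ^ 2) :=
    mul_le_mul_of_nonneg_left hE (by positivity)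
  have h8 := mul_le_mul_of_nonneg_left h6 (by positivity : (0 : ℝ) ≤ (q : ℝ) ^ 2)
  nlinarith

theorem cf_bound (μ : Measure ℤ) [IsProbabilityMeasure μ]
    (hsupp : μ (({-1, 0, 1} : Set ℤ)ᶜ) = 0)
    (hC : ∀ x ∈ ({-1, 0, 1} : Set ℤ), μ.real {x} < 1) :
    ∃ c : ℝ, 0 < c ∧ ∃ d : ℕ, (d = 1 ∨ d = 2) ∧ ∀ z : ℂ, ‖z‖ = 1 →
      ‖∫ x : ℤ, z ^ x ∂μ‖ ^ 2 ≤ Real.exp (- (c * ‖z ^ d - 1‖ ^ 2)) := by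
  have hint : ∀ g : ℤ → ℂ, ∫ x, g x ∂μ = μ.real {-1} * g (-1) + μ.real {0} * g 0 + μ.real {1} * g 1 := by
    intro g
    have hr : μ.restrict (({-1, 0, 1} : Finset ℤ) : Set ℤ) = μ := by
      apply Measure.restrict_eq_self_of_ae_mem
      rw [ae_iff]
      simpa [Set.compl_def] using hsupp
    rw [← hr, setIntegral_finset, hr]
    · simp [Finset.sum_insert]
      ring
    · exact Integrable.of_bound (C := ‖g (-1)‖ + ‖g 0‖ + ‖g 1‖)
        (measurable_of_countable _).aestronglyMeasurable (by
          refine (ae_restrict_iff' MeasurableSet.of_discrete).mpr (Eventually.of_forall fun x hx => ?_)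
          have h1 := norm_nonneg (g (-1))
          have h2 := norm_nonneg (g 0)
          have h3 := norm_nonneg (g 1)
          simp at hx
          rcases hx with rfl | rfl | rfl <;> linarith)
  set A := μ.real {-1} with hA
  set B := μ.real {0} with hB
  set D := μ.real {1} with hD
  have hA0 : 0 ≤ A := measureReal_nonneg
  have hB0 : 0 ≤ B := measureReal_nonneg
  have hD0 : 0 ≤ D := measureReal_nonneg
  have hA1 : A < 1 := hC _ (by simp)
  have hB1 : B < 1 := hC _ (by simp)
  have hD1 : D < 1 := hC _ (by simp)
  have hsum : A + B + D = 1 := by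
    have := hint (fun _ => 1)
    simp at this
    exact_mod_cast this.symm
  have key : ∀ z : ℂ, ‖z‖ = 1 → ‖∫ x : ℤ, z ^ x ∂μ‖ ^ 2
      = 1 - B * (A + D) * ‖z ^ 1 - 1‖ ^ 2 - A * D * ‖z ^ 2 - 1‖ ^ 2 := by
    intro z hz
    have hz0 : z ≠ 0 := by intro h; simp [h] at hz
    have e : ∫ x : ℤ, z ^ x ∂μ = z⁻¹ * (A + B * z + D * z ^ 2) := by
      rw [hint]; simp; field_simp
    rw [e, norm_mul, norm_inv, hz, inv_one, one_mul]
    have hn : z.re * z.re + z.im * z.im = 1 := by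
      have := Complex.sq_norm z
      rw [hz, Complex.normSq_apply] at this; linarith
    simp only [Complex.sq_norm, Complex.normSq_apply]
    simp [pow_two]
    obtain ⟨x, y⟩ := z
    simp only at hn ⊢
    have hA' : A = 1 - B - D := by linarith
    have hy : y ^ 2 = 1 - x ^ 2 := by linarith
    rw [hA']
    ring_nf
    have hy4 : y ^ 4 = (1 - x ^ 2) ^ 2 := by rw [← hy]; ring
    simp only [hy, hy4]
    ring
  by_cases h : 0 < B * (A + D)
  · refine ⟨_, h, 1, Or.inl rfl, fun z hz => ?_⟩
    rw [key z hz]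
    have := Real.add_one_le_exp (-(B * (A + D) * ‖z ^ 1 - 1‖ ^ 2))
    have : 0 ≤ A * D * ‖z ^ 2 - 1‖ ^ 2 := by positivity
    linarith
  · have h' : 0 < A * D := by
      have hAD : 0 < A + D := by linarith
      have : B = 0 := by
        by_contra hne
        exact h (mul_pos (lt_of_le_of_ne hB0 (Ne.symm hne)) hAD)
      exact mul_pos (by linarith) (by linarith)
    refine ⟨_, h', 2, Or.inr rfl, fun z hz => ?_⟩
    rw [key z hz]
    have := Real.add_one_le_exp (-(A * D * ‖z ^ 2 - 1‖ ^ 2))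
    have : 0 ≤ B * (A + D) * ‖z ^ 1 - 1‖ ^ 2 := by positivity
    linarith

theorem conc (μ : Measure ℤ) [IsProbabilityMeasure μ] (c : ℝ) (hc : 0 < c) (d : ℕ)
    (hd : d = 1 ∨ d = 2)
    (hcf : ∀ z : ℂ, ‖z‖ = 1 → ‖∫ x : ℤ, z ^ x ∂μ‖ ^ 2 ≤ Real.exp (- (c * ‖z ^ d - 1‖ ^ 2)))
    (q m : ℕ) (hq : Odd q) (hm : 2 * q ^ 2 ≤ m) (u : ℤ) :
    (Measure.pi fun _ : Fin m => μ).real {x | ∑ i : Fin m, (i : ℤ) * x i = u}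
      ≤ 1 / (q : ℝ) ^ 3 + Real.exp (- (c * m / (4 * q ^ 2))) := by
  have hq0 : 0 < q := hq.pos
  set N := q ^ 3 with hN
  have hN0 : N ≠ 0 := by positivity
  set P := Measure.pi fun _ : Fin m => μ with hP
  set ζ : ℂ := Complex.exp (2 * Real.pi * Complex.I / N) with hζ
  have hprim : IsPrimitiveRoot ζ N := Complex.isPrimitiveRoot_exp N hN0
  have hζn : ‖ζ‖ = 1 := hprim.norm'_eq_one hN0
  have hζ0 : ζ ≠ 0 := hprim.ne_zero hN0
  set U : (Fin m → ℤ) → ℤ := fun x => ∑ i : Fin m, (i : ℤ) * x i with hU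
  -- expectation of characters
  have hchar : ∀ z : ℂ, z ≠ 0 → ∫ x, z ^ (U x) ∂P = ∏ i : Fin m, ∫ x : ℤ, (z ^ (i : ℕ)) ^ x ∂μ := by
    intro z hz
    rw [← integral_fintype_prod_eq_prod (𝕜 := ℂ) (fun i : Fin m => fun x : ℤ => (z ^ (i : ℕ)) ^ x)]
    congr 1
    ext x
    simp only [hU]
    have hz' : ∀ s : Finset (Fin m), z ^ (∑ i ∈ s, ((i : ℕ) : ℤ) * x i) = ∏ i ∈ s, (z ^ (i : ℕ)) ^ x i := by
      intro s
      classical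
      induction s using Finset.induction_on with
      | empty => simp
      | insert a s ha ih =>
        rw [Finset.sum_insert ha, Finset.prod_insert ha, zpow_add₀ hz, ih, zpow_mul, zpow_natCast]
    exact hz' _
  have hbd : ∀ b ∈ Finset.range N, b ≠ 0 →
      ‖∫ x, (ζ ^ b) ^ (U x) ∂P‖ ≤ Real.exp (- (c * m / (4 * q ^ 2))) := by
    intro b hb hb0
    have hbN : b < N := Finset.mem_range.mp hb
    have hz1 : ‖ζ ^ b‖ = 1 := by simp [hζn]
    rw [hchar _ (pow_ne_zero _ hζ0), norm_prod]
    have hw : (ζ ^ b) ^ d ≠ 1 := by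
      rw [← pow_mul, Ne, hprim.pow_eq_one_iff_dvd]
      intro hdv
      have hcop : Nat.Coprime N d := by
        rcases hd with rfl | rfl
        · simp
        · exact (hq.pow).coprime_two_right
      exact hb0 (Nat.eq_zero_of_dvd_of_lt (hcop.dvd_of_dvd_mul_right hdv) hbN)
    have hlb := sum_lb ((ζ ^ b) ^ d) q m hq0 hm
      (by rw [← hN, ← pow_mul, ← pow_mul, hprim.pow_eq_one_iff_dvd]; exact ⟨b * d, by ring⟩) hw
      (by simp [hζn])
    refine (sq_le_sq₀ (by positivity) (Real.exp_nonneg _)).mp ?_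
    rw [← Finset.prod_pow, ← Real.exp_nat_mul]
    calc ∏ i : Fin m, ‖∫ x : ℤ, ((ζ ^ b) ^ (i : ℕ)) ^ x ∂μ‖ ^ 2
        ≤ ∏ i : Fin m, Real.exp (- (c * ‖((ζ ^ b) ^ d) ^ (i : ℕ) - 1‖ ^ 2)) := by
          refine Finset.prod_le_prod (fun _ _ => by positivity) fun i _ => ?_
          have := hcf ((ζ ^ b) ^ (i : ℕ)) (by simp [hζn])
          rwa [pow_right_comm (ζ ^ b)] at this
      _ = Real.exp (- (c * ∑ i ∈ Finset.range m, ‖((ζ ^ b) ^ d) ^ i - 1‖ ^ 2)) := by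
          rw [← Real.exp_sum, Finset.sum_neg_distrib, ← Finset.mul_sum,
            Fin.sum_univ_eq_sum_range (fun i => ‖((ζ ^ b) ^ d) ^ i - 1‖ ^ 2) m]
      _ ≤ _ := by
          apply Real.exp_le_exp.mpr
          have := mul_le_mul_of_nonneg_left hlb hc.le
          have e : ((2 : ℕ) : ℝ) * -(c * m / (4 * q ^ 2)) = - (c * (m / (2 * q ^ 2))) := by
            push_cast; field_simp; ring
          rw [e]; linarith
  -- orthogonality
  have horth : ∀ x, (N : ℝ) * Set.indicator {x | U x = u} (fun _ => (1 : ℝ)) x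
      ≤ (∑ b ∈ Finset.range N, (ζ ^ b) ^ (-u) * (ζ ^ b) ^ (U x)).re := by
    intro x
    have e : ∑ b ∈ Finset.range N, (ζ ^ b) ^ (-u) * (ζ ^ b) ^ (U x)
        = ∑ b ∈ Finset.range N, (ζ ^ (U x - u)) ^ b := by
      refine Finset.sum_congr rfl fun b _ => ?_
      rw [← zpow_add₀ (pow_ne_zero _ hζ0), ← zpow_natCast, ← zpow_mul, ← zpow_natCast, ← zpow_mul]
      congr 1; ring
    rw [e]
    by_cases h1 : ζ ^ (U x - u) = 1
    · simp only [h1, one_pow]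
      have : Set.indicator {x | U x = u} (fun _ => (1 : ℝ)) x ≤ 1 :=
        Set.indicator_le_self' (fun _ _ => zero_le_one) x
      simpa using mul_le_mul_of_nonneg_left this (Nat.cast_nonneg N)
    · have hne : U x ≠ u := by intro h; apply h1; simp [h]
      have hs : ∑ b ∈ Finset.range N, (ζ ^ (U x - u)) ^ b = 0 := by
        have := geom_sum_mul (ζ ^ (U x - u)) N
        have h2 : (ζ ^ (U x - u)) ^ N = 1 := by
          rw [← zpow_natCast, ← zpow_mul, mul_comm, zpow_mul, zpow_natCast, hprim.pow_eq_one, one_zpow]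
        rw [h2, sub_self] at this
        exact (mul_eq_zero.mp this).resolve_right (sub_ne_zero.mpr h1)
      rw [hs]
      simp [hne]
  have hintg : ∀ b : ℕ, Integrable (fun x => (ζ ^ b) ^ (-u) * (ζ ^ b) ^ (U x)) P := by
    intro b
    refine Integrable.of_bound (C := 1) (measurable_of_countable _).aestronglyMeasurable ?_
    refine Eventually.of_forall fun x => ?_
    simp [hζn]
  have h1 : (N : ℝ) * P.real {x | U x = u}
      ≤ (∑ b ∈ Finset.range N, (ζ ^ b) ^ (-u) * ∫ x, (ζ ^ b) ^ (U x) ∂P).re := by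
    have hI : Integrable (fun x => ∑ b ∈ Finset.range N, (ζ ^ b) ^ (-u) * (ζ ^ b) ^ (U x)) P :=
      integrable_finsetSum _ fun b _ => hintg b
    have h2 := integral_mono (μ := P)
      ((Integrable.indicator (integrable_const (1 : ℝ)) MeasurableSet.of_discrete).const_mul (N : ℝ))
      hI.re horth
    have h3 : ∫ x, (∑ b ∈ Finset.range N, (ζ ^ b) ^ (-u) * (ζ ^ b) ^ (U x)).re ∂P
        = (∫ x, (∑ b ∈ Finset.range N, (ζ ^ b) ^ (-u) * (ζ ^ b) ^ (U x)) ∂P).re :=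
      integral_re hI
    rw [integral_const_mul, integral_indicator_const _ MeasurableSet.of_discrete] at h2
    rw [smul_eq_mul, mul_one] at h2
    refine h2.trans (le_of_eq (h3.trans ?_))
    rw [integral_finsetSum _ fun b _ => hintg b]
    simp only [integral_const_mul]
  have h2 : (N : ℝ) * P.real {x | U x = u}
      ≤ 1 + N * Real.exp (- (c * m / (4 * q ^ 2))) := by
    refine h1.trans ((Complex.re_le_norm _).trans ((norm_sum_le _ _).trans ?_))
    have hpt : ∀ b ∈ Finset.range N, ‖(ζ ^ b) ^ (-u) * ∫ x, (ζ ^ b) ^ (U x) ∂P‖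
        ≤ (if b = 0 then 1 else 0) + Real.exp (- (c * m / (4 * q ^ 2))) := by
      intro b hb
      rw [norm_mul, norm_zpow, norm_pow, hζn, one_pow, one_zpow, one_mul]
      split_ifs with h
      · subst h
        have : 0 ≤ Real.exp (- (c * m / (4 * q ^ 2))) := Real.exp_nonneg _
        simpa using this
      · rw [zero_add]; exact hbd b hb h
    refine (Finset.sum_le_sum hpt).trans ?_
    rw [Finset.sum_add_distrib]
    simp [Nat.pos_of_ne_zero hN0]
  have hNpos : (0 : ℝ) < N := by positivity
  have h3 : P.real {x | U x = u} ≤ (1 + N * Real.exp (- (c * m / (4 * q ^ 2)))) / N := by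
    rw [le_div_iff₀ hNpos]; linarith
  refine h3.trans (le_of_eq ?_)
  rw [add_div, mul_div_cancel_left₀ _ hNpos.ne', hN]
  push_cast; rfl
theorem eval_polyOf (n : ℕ) (a : Fin (n + 1) → ℤ) (z : ℂ) :
    (polyOf n a).eval z = ∑ j, (a j : ℂ) * z ^ (j : ℕ) := by
  simp [polyOf, Polynomial.eval_finsetSum]

theorem eval_deriv_polyOf (n : ℕ) (a : Fin (n + 1) → ℤ) (z : ℂ) :
    z * (Polynomial.derivative (polyOf n a)).eval z
      = ∑ j, (a j : ℂ) * ((j : ℕ) * z ^ (j : ℕ)) := by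
  simp only [polyOf, Polynomial.derivative_sum, Polynomial.eval_finsetSum, Finset.mul_sum]
  refine Finset.sum_congr rfl fun j _ => ?_
  simp only [Polynomial.derivative_C_mul_X_pow, Polynomial.eval_mul, Polynomial.eval_C,
    Polynomial.eval_pow, Polynomial.eval_X]
  rcases Nat.eq_zero_or_pos (j : ℕ) with h | h
  · simp [h]
  · obtain ⟨r, hr⟩ : ∃ r, (j : ℕ) = r + 1 := ⟨j - 1, by omega⟩
    rw [hr, pow_succ]; simp; ring

theorem large_bound (μ : Measure ℤ) [IsProbabilityMeasure μ] (p : ENNReal)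
    (hp : ∀ x, μ {x} ≤ p) (n : ℕ) (α : ℂ) (hd : (minpoly ℚ α).natDegree ≤ n + 1) :
    (Measure.pi fun _ : Fin (n + 1) => μ) {a | (polyOf n a).eval α = 0}
      ≤ p ^ (minpoly ℚ α).natDegree := by
  apply le_of_sections μ (Fin.castLE hd) (Fin.castLE_injective hd)
  intro b
  have hsub : Set.Subsingleton {x : Fin (minpoly ℚ α).natDegree → ℤ |
      Function.extend (Fin.castLE hd) x b ∈ {a | (polyOf n a).eval α = 0}} := by
    intro x hx y hy
    simp only [Set.mem_ofPred_eq, eval_polyOf] at hx hy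
    have h := sum_extend_sub (Fin.castLE hd) (Fin.castLE_injective hd) x y b
      (fun j => α ^ (j : ℕ))
    rw [hx, hy, sub_self] at h
    have hli := Fintype.linearIndependent_iff.mp (linearIndependent_pow (K := ℚ) α)
      (fun i => ((x i - y i : ℤ) : ℚ)) (by
        rw [h]
        refine Finset.sum_congr rfl fun i _ => ?_
        rw [Algebra.smul_def]; simp)
    ext i
    have := hli i
    have : x i - y i = 0 := by exact_mod_cast this
    omega
  rcases hsub.eq_empty_or_singleton with h | ⟨x, h⟩
  · rw [h]; simp
  · rw [h, Measure.pi_singleton]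
    calc _ ≤ ∏ _i : Fin (minpoly ℚ α).natDegree, p := Finset.prod_le_prod' fun i _ => hp _
      _ = _ := by simp

theorem real_indep (α : ℂ) (h : α.im ≠ 0) (s t : ℤ) (hst : (s : ℂ) + t * α = 0) : s = 0 ∧ t = 0 := by
  have h1 := congrArg Complex.im hst
  have h2 := congrArg Complex.re hst
  simp at h1 h2
  have ht : t = 0 := by
    rcases h1 with h1 | h1
    · exact h1
    · exact absurd h1 h
  subst ht
  simp at h2
  exact ⟨h2, rfl⟩

theorem small_bound (μ : Measure ℤ) [IsProbabilityMeasure μ] (n k m : ℕ) (hk : 2 ≤ k)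
    (hkm : k * m ≤ n) (α : ℂ) (hα : α ^ k = 1) (him : α.im ≠ 0) (C : ENNReal)
    (hC : ∀ u : ℤ, (Measure.pi fun _ : Fin m => μ) {x | ∑ i : Fin m, (i : ℤ) * x i = u} ≤ C) :
    (Measure.pi fun _ : Fin (n + 1) => μ) {a | isDoubleRootAt n a α} ≤ C * C := by
  have hb : ∀ i : Fin m, k * (i : ℕ) + 2 ≤ n := by
    intro i
    have := i.2
    have h2 : k * ((i : ℕ) + 1) ≤ k * m := Nat.mul_le_mul_left _ this
    have h3 : k * ((i : ℕ) + 1) = k * i + k := by ring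
    omega
  let f : Fin m ⊕ Fin m → Fin (n + 1) :=
    Sum.elim (fun i => ⟨k * i, by have := hb i; omega⟩) (fun i => ⟨k * i + 1, by have := hb i; omega⟩)
  have hmod : ∀ a b : ℕ, k * a ≠ k * b + 1 := by
    intro a b h
    have h1 := congrArg (· % k) h
    simp only [Nat.mul_mod_right, Nat.mul_add_mod] at h1
    rw [Nat.mod_eq_of_lt (by omega)] at h1
    omega
  have hf : Function.Injective f := by
    rintro (i | i) (j | j) h
    · simp only [f, Sum.elim_inl, Fin.mk.injEq] at h
      congr 1; ext; exact Nat.eq_of_mul_eq_mul_left (by omega) h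
    · simp only [f, Sum.elim_inl, Sum.elim_inr, Fin.mk.injEq] at h
      exact absurd h (hmod _ _)
    · simp only [f, Sum.elim_inl, Sum.elim_inr, Fin.mk.injEq] at h
      exact absurd h.symm (hmod _ _)
    · simp only [f, Sum.elim_inr, Fin.mk.injEq] at h
      congr 1; ext; exact Nat.eq_of_mul_eq_mul_left (by omega) (Nat.succ_injective h)
  apply le_of_sections μ f hf
  intro b
  set V := {x : Fin m ⊕ Fin m → ℤ | Function.extend f x b ∈ {a | isDoubleRootAt n a α}} with hV
  rcases Set.eq_empty_or_nonempty V with h | ⟨y, hy⟩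
  · rw [h]; simp
  have hsub : V ⊆ (MeasurableEquiv.sumPiEquivProdPi (fun _ : Fin m ⊕ Fin m => ℤ)) ⁻¹'
      ({x | ∑ i : Fin m, (i : ℤ) * x i = ∑ i : Fin m, (i : ℤ) * y (Sum.inl i)} ×ˢ
       {x | ∑ i : Fin m, (i : ℤ) * x i = ∑ i : Fin m, (i : ℤ) * y (Sum.inr i)}) := by
    intro x hx
    have hpow : ∀ i : ℕ, α ^ (k * i) = 1 := fun i => by rw [pow_mul, hα, one_pow]
    have e1 := sum_extend_sub f hf x y b (fun j => α ^ (j : ℕ))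
    have e2 := sum_extend_sub f hf x y b (fun j => (j : ℕ) * α ^ (j : ℕ))
    simp only [hV, Set.mem_ofPred_eq, isDoubleRootAt] at hx hy
    rw [← eval_polyOf, ← eval_polyOf, hx.1, hy.1, sub_self, Fintype.sum_sum_type] at e1
    rw [← eval_deriv_polyOf, ← eval_deriv_polyOf, hx.2, hy.2, mul_zero, sub_self,
      Fintype.sum_sum_type] at e2
    simp only [f, Sum.elim_inl, Sum.elim_inr, pow_succ, hpow, one_mul, mul_one] at e1 e2
    obtain ⟨s0, s1⟩ := real_indep α him (∑ i : Fin m, (x (Sum.inl i) - y (Sum.inl i)))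
      (∑ i : Fin m, (x (Sum.inr i) - y (Sum.inr i))) (by
        rw [e1, Int.cast_sum, Int.cast_sum, Finset.sum_mul])
    obtain ⟨t0, t1⟩ := real_indep α him
      (∑ i : Fin m, (x (Sum.inl i) - y (Sum.inl i)) * ((k * (i : ℕ) : ℕ) : ℤ))
      (∑ i : Fin m, (x (Sum.inr i) - y (Sum.inr i)) * ((k * (i : ℕ) + 1 : ℕ) : ℤ)) (by
        rw [e2, Int.cast_sum, Int.cast_sum, Finset.sum_mul]
        congr 1
        · refine Finset.sum_congr rfl fun i _ => ?_
          push_cast; ring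
        · refine Finset.sum_congr rfl fun i _ => ?_
          push_cast; ring)
    have hk0 : (k : ℤ) ≠ 0 := by positivity
    have u0 : (k : ℤ) * (∑ i : Fin m, (i : ℤ) * x (Sum.inl i) - ∑ i : Fin m, (i : ℤ) * y (Sum.inl i)) = 0 := by
      rw [← t0, ← Finset.sum_sub_distrib, Finset.mul_sum]
      refine Finset.sum_congr rfl fun i _ => ?_
      push_cast; ring
    have u1 : (k : ℤ) * (∑ i : Fin m, (i : ℤ) * x (Sum.inr i) - ∑ i : Fin m, (i : ℤ) * y (Sum.inr i)) = 0 := by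
      rw [← sub_zero (0 : ℤ)]
      nth_rewrite 1 [← t1]
      rw [← s1, ← Finset.sum_sub_distrib, ← Finset.sum_sub_distrib, Finset.mul_sum]
      refine Finset.sum_congr rfl fun i _ => ?_
      push_cast; ring
    have v0 := (mul_eq_zero.mp u0).resolve_left hk0
    have v1 := (mul_eq_zero.mp u1).resolve_left hk0
    exact ⟨sub_eq_zero.mp v0, sub_eq_zero.mp v1⟩
  refine (measure_mono hsub).trans ?_
  rw [(measurePreserving_sumPiEquivProdPi (fun _ : Fin m ⊕ Fin m => μ)).measure_preimage
    (MeasurableSet.of_discrete).nullMeasurableSet, Measure.prod_prod]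
  exact mul_le_mul' (hC _) (hC _)

theorem union_bound (n M : ℕ) (K : Finset ℕ) (hK : K ⊆ Finset.Icc 1 M)
    (P : Measure (Fin (n + 1) → ℤ)) (F : ℕ → ℂ → Set (Fin (n + 1) → ℤ)) (C : ENNReal)
    (hF : ∀ k ∈ K, ∀ α ∈ primitiveRoots k ℂ, P (F k α) ≤ C) :
    P (⋃ k ∈ K, ⋃ α ∈ primitiveRoots k ℂ, F k α) ≤ M * M * C := by
  calc _ ≤ ∑ k ∈ K, P (⋃ α ∈ primitiveRoots k ℂ, F k α) := measure_biUnion_finset_le _ _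
    _ ≤ ∑ k ∈ K, (M : ENNReal) * C := by
      refine Finset.sum_le_sum fun k hk => ?_
      refine (measure_biUnion_finset_le _ _).trans ((Finset.sum_le_sum (hF k hk)).trans ?_)
      rw [Finset.sum_const, nsmul_eq_mul, Complex.card_primitiveRoots]
      gcongr
      exact (Nat.totient_le k).trans (Finset.mem_Icc.mp (hK hk)).2
    _ ≤ M * (M * C) := by
      rw [Finset.sum_const, nsmul_eq_mul]
      gcongr
      simpa using Finset.card_le_card hK
    _ = _ := by rw [mul_assoc]

theorem natDegree_minpoly_prim (k : ℕ) (hk : 0 < k) (α : ℂ) (h : IsPrimitiveRoot α k) :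
    (minpoly ℚ α).natDegree = k.totient := by
  rw [← Polynomial.cyclotomic_eq_minpoly_rat h hk, Polynomial.natDegree_cyclotomic]

theorem totient_le_of_root (n k : ℕ) (hk : 0 < k) (α : ℂ) (h : IsPrimitiveRoot α k)
    (a : Fin (n + 1) → ℤ) (ha : a ≠ 0) (hr : (polyOf n a).eval α = 0) : k.totient ≤ n := by
  by_contra hlt
  push Not at hlt
  rw [← natDegree_minpoly_prim k hk α h] at hlt
  have hli := (linearIndependent_pow (K := ℚ) α).comp (Fin.castLE hlt) (Fin.castLE_injective hlt)
  have := Fintype.linearIndependent_iff.mp hli (fun i => ((a i : ℤ) : ℚ)) (by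
    rw [← hr, eval_polyOf]
    refine Finset.sum_congr rfl fun i _ => ?_
    rw [Algebra.smul_def]; simp)
  apply ha
  ext i
  exact_mod_cast this i

theorem im_ne (α : ℂ) (k : ℕ) (hk : k ≠ 0) (h : α ^ k = 1) (h1 : α ≠ -1) (h2 : α ≠ 1) :
    α.im ≠ 0 := by
  intro him
  have hn : ‖α‖ = 1 := Complex.norm_eq_one_of_pow_eq_one h hk
  have := Complex.sq_norm α
  rw [hn, Complex.normSq_apply, him] at this
  have h3 : (α.re - 1) * (α.re + 1) = 0 := by linarith
  rcases mul_eq_zero.mp h3 with h | h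
  · exact h2 (Complex.ext (by simp; linarith) (by simp [him]))
  · exact h1 (Complex.ext (by simp; linarith) (by simp [him]))

theorem combine (μ : Measure ℤ) [IsProbabilityMeasure μ] (c : ℝ) (hc : 0 < c) (d : ℕ)
    (hd : d = 1 ∨ d = 2)
    (hcf : ∀ z : ℂ, ‖z‖ = 1 → ‖∫ x : ℤ, z ^ x ∂μ‖ ^ 2 ≤ Real.exp (- (c * ‖z ^ d - 1‖ ^ 2)))
    (p : ℝ) (hp0 : 0 ≤ p) (hp1 : p ≤ 1) (hp : ∀ x, μ {x} ≤ ENNReal.ofReal p)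
    (n s : ℕ) (hs : 18 ≤ s) (hsn : s ^ 20 ≤ n) :
    ((Measure.pi fun _ : Fin (n + 1) => μ)
          {a | ∃ α : ℂ, isDoubleRootAt n a α ∧ (∃ k : ℕ, 1 ≤ k ∧ α ^ k = 1) ∧
                α ≠ -1 ∧ α ≠ 1}).toReal
    ≤ (2 * s ^ 2) * (2 * s ^ 2) *
        ((1 / (s : ℝ) ^ 24 + Real.exp (-(c / 36)) ^ s) * (1 / (s : ℝ) ^ 24 + Real.exp (-(c / 36)) ^ s))
      + (2 * n ^ 2) * (2 * n ^ 2) * p ^ s := by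
  set P := Measure.pi fun _ : Fin (n + 1) => μ with hP
  set R : ℝ := 1 / (s : ℝ) ^ 24 + Real.exp (-(c / 36)) ^ s with hR
  have hR0 : 0 ≤ R := by positivity
  have hs0 : 0 < s := by omega
  have hs0' : (0 : ℝ) < s := by exact_mod_cast hs0
  -- concentration
  have hconc : ∀ u : ℤ, (Measure.pi fun _ : Fin (s ^ 17) => μ)
      {x | ∑ i : Fin (s ^ 17), (i : ℤ) * x i = u} ≤ ENNReal.ofReal R := by
    intro u
    have hq3 : 2 * s ^ 8 + 1 ≤ 3 * s ^ 8 := by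
      have := Nat.one_le_pow 8 s hs0
      omega
    have hq2 : (2 * s ^ 8 + 1) ^ 2 ≤ 9 * s ^ 16 := by
      calc _ ≤ (3 * s ^ 8) ^ 2 := Nat.pow_le_pow_left hq3 2
        _ = _ := by ring
    have h := conc μ c hc d hd hcf (2 * s ^ 8 + 1) (s ^ 17) (by simp) (by
      calc _ ≤ 2 * (9 * s ^ 16) := Nat.mul_le_mul_left _ hq2
        _ = 18 * s ^ 16 := by ring
        _ ≤ s * s ^ 16 := Nat.mul_le_mul_right _ hs
        _ = _ := by ring) u
    rw [← ofReal_measureReal]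
    apply ENNReal.ofReal_le_ofReal
    refine h.trans ?_
    rw [hR]
    have hq2' : (((2 * s ^ 8 + 1 : ℕ) : ℝ)) ^ 2 ≤ 9 * (s : ℝ) ^ 16 := by exact_mod_cast hq2
    refine add_le_add ?_ ?_
    · apply one_div_le_one_div_of_le (by positivity)
      have : (s : ℝ) ^ 8 ≤ ((2 * s ^ 8 + 1 : ℕ) : ℝ) := by
        push_cast; nlinarith [pow_pos hs0' 8]
      calc (s : ℝ) ^ 24 = ((s : ℝ) ^ 8) ^ 3 := by ring
        _ ≤ _ := by gcongr
    · rw [← Real.exp_nat_mul]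
      apply Real.exp_le_exp.mpr
      have : (s : ℝ) * (c / 36) ≤ c * ((s ^ 17 : ℕ) : ℝ) / (4 * ((2 * s ^ 8 + 1 : ℕ) : ℝ) ^ 2) := by
        rw [le_div_iff₀ (by positivity)]
        calc (s : ℝ) * (c / 36) * (4 * ((2 * s ^ 8 + 1 : ℕ) : ℝ) ^ 2)
            ≤ (s : ℝ) * (c / 36) * (4 * (9 * (s : ℝ) ^ 16)) := by gcongr
          _ = _ := by push_cast; ring
      linarith
  have hsmall := union_bound n (2 * s ^ 2) (Finset.Icc 1 (2 * s ^ 2)) (subset_refl _) P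
    (fun _ α => {a | isDoubleRootAt n a α ∧ α.im ≠ 0}) (ENNReal.ofReal R * ENNReal.ofReal R) (by
      intro k hk α hα
      have hk1 := Finset.mem_Icc.mp hk
      have hprim := (mem_primitiveRoots (by omega)).mp hα
      by_cases him : α.im = 0
      · simp [him]
      · have hk2 : 2 ≤ k := by
          by_contra hlt
          have : k = 1 := by omega
          subst this
          have : α = 1 := by simpa using hprim.pow_eq_one
          exact him (by simp [this])
        refine (measure_mono fun a ha => ha.1).trans
          (small_bound μ n k (s ^ 17) hk2 ?_ α hprim.pow_eq_one him _ hconc)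
        calc k * s ^ 17 ≤ (2 * s ^ 2) * s ^ 17 := Nat.mul_le_mul_right _ hk1.2
          _ = 2 * s ^ 19 := by ring
          _ ≤ s * s ^ 19 := Nat.mul_le_mul_right _ (by omega)
          _ = s ^ 20 := by ring
          _ ≤ n := hsn)
  have hlarge := union_bound n (2 * n ^ 2) (Finset.Ioc (2 * s ^ 2) (2 * n ^ 2)) (by
      intro k hk
      rw [Finset.mem_Ioc] at hk
      rw [Finset.mem_Icc]; omega) P
    (fun k α => {a | (polyOf n a).eval α = 0 ∧ k.totient ≤ n}) (ENNReal.ofReal p ^ s) (by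
      intro k hk α hα
      rw [Finset.mem_Ioc] at hk
      have hk0 : 0 < k := by omega
      have hprim := (mem_primitiveRoots hk0).mp hα
      by_cases hle : k.totient ≤ n
      · have hdeg := natDegree_minpoly_prim k hk0 α hprim
        refine (measure_mono fun a ha => ha.1).trans
          ((large_bound μ _ hp n α (by omega)).trans ?_)
        rw [hdeg]
        apply pow_le_pow_right_of_le_one' (by simpa using hp1)
        have := (totient_lb k).1
        have h2 : s ^ 2 < k.totient ^ 2 := by omega
        exact (lt_of_pow_lt_pow_left₀ 2 (Nat.zero_le _) h2).le
      · simp [hle])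
  have hsub : {a | ∃ α : ℂ, isDoubleRootAt n a α ∧ (∃ k : ℕ, 1 ≤ k ∧ α ^ k = 1) ∧
                α ≠ -1 ∧ α ≠ 1} ⊆
      (⋃ k ∈ Finset.Icc 1 (2 * s ^ 2), ⋃ α ∈ primitiveRoots k ℂ,
        {a | isDoubleRootAt n a α ∧ α.im ≠ 0}) ∪
      (⋃ k ∈ Finset.Ioc (2 * s ^ 2) (2 * n ^ 2), ⋃ α ∈ primitiveRoots k ℂ,
        {a | (polyOf n a).eval α = 0 ∧ k.totient ≤ n}) := by
    rintro a ⟨α, hdr, ⟨k, hk, hαk⟩, hn1, h1⟩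
    by_cases ha : a = 0
    · left
      simp only [Set.mem_iUnion]
      refine ⟨4, ?_, Complex.I, ?_, ?_, ?_⟩
      · rw [Finset.mem_Icc]; constructor
        · norm_num
        · nlinarith
      · rw [mem_primitiveRoots (by norm_num)]
        exact Complex.isPrimitiveRoot_I
      · subst ha; simp [isDoubleRootAt, polyOf]
      · simp
    · have him := im_ne α k (by omega) hαk hn1 h1
      have hfin : IsOfFinOrder α := isOfFinOrder_iff_pow_eq_one.mpr ⟨k, hk, hαk⟩
      have hprim := IsPrimitiveRoot.orderOf α
      have hpos : 0 < orderOf α := hfin.orderOf_pos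
      by_cases hle : orderOf α ≤ 2 * s ^ 2
      · left
        simp only [Set.mem_iUnion]
        exact ⟨orderOf α, Finset.mem_Icc.mpr ⟨hpos, hle⟩, α, (mem_primitiveRoots hpos).mpr hprim,
          hdr, him⟩
      · right
        have ht := totient_le_of_root n _ hpos α hprim a ha hdr.1
        simp only [Set.mem_iUnion]
        refine ⟨orderOf α, Finset.mem_Ioc.mpr ⟨by omega, ?_⟩, α, (mem_primitiveRoots hpos).mpr hprim,
          hdr.1, ht⟩
        calc _ ≤ _ := (totient_lb (orderOf α)).1
          _ ≤ _ := by gcongr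
  clear_value R
  apply ENNReal.toReal_le_of_le_ofReal (by positivity)
  refine (measure_mono hsub).trans ((measure_union_le _ _).trans ((add_le_add hsmall hlarge).trans
    (le_of_eq ?_)))
  have e1 : ENNReal.ofReal (2 * (s : ℝ) ^ 2) = ((2 * s ^ 2 : ℕ) : ENNReal) := by
    rw [← ENNReal.ofReal_natCast]; push_cast; rfl
  have e2 : ENNReal.ofReal (2 * (n : ℝ) ^ 2) = ((2 * n ^ 2 : ℕ) : ENNReal) := by
    rw [← ENNReal.ofReal_natCast]; push_cast; rfl
  rw [← e1, ← e2, ← ENNReal.ofReal_pow hp0, ← ENNReal.ofReal_mul (by positivity),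
    ← ENNReal.ofReal_mul (by positivity), ← ENNReal.ofReal_mul (by positivity),
    ← ENNReal.ofReal_mul (by positivity), ← ENNReal.ofReal_mul (by positivity),
    ← ENNReal.ofReal_add (by positivity) (by positivity)]

theorem double_root_at_other_roots_of_unity (μ : MeasureTheory.Measure ℤ)
    [IsProbabilityMeasure μ]
    (hsupp : μ (({-1, 0, 1} : Set ℤ)ᶜ) = 0)
    (hC : ∀ x ∈ ({-1, 0, 1} : Set ℤ), (μ {x}).toReal < 1 / Real.sqrt 3) :
    Tendsto (fun n : ℕ => (n : ℝ) ^ 2 *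
        ((Measure.pi fun _ : Fin (n + 1) => μ)
          {a | ∃ α : ℂ, isDoubleRootAt n a α ∧ (∃ k : ℕ, 1 ≤ k ∧ α ^ k = 1) ∧
                α ≠ -1 ∧ α ≠ 1}).toReal)
      atTop (nhds 0) := by
  set p : ℝ := 1 / Real.sqrt 3 with hpdef
  have hp0 : 0 ≤ p := by positivity
  have hp1 : p < 1 := by
    rw [hpdef, div_lt_one (by positivity)]
    rw [Real.lt_sqrt (by norm_num)]; norm_num
  have hp : ∀ x, μ {x} ≤ ENNReal.ofReal p := by
    intro x
    by_cases hx : x ∈ ({-1, 0, 1} : Set ℤ)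
    · rw [← ENNReal.ofReal_toReal (measure_ne_top μ {x})]
      exact ENNReal.ofReal_le_ofReal (hC x hx).le
    · have : μ {x} = 0 := measure_mono_null (by simpa using hx) hsupp
      simp [this]
  obtain ⟨c, hc, d, hd, hcf⟩ := cf_bound μ hsupp (fun x hx => (hC x hx).trans hp1)
  set ρ := Real.exp (-(c / 36)) with hρ
  have hρ0 : 0 < ρ := Real.exp_pos _
  have hρ1 : ρ < 1 := by rw [hρ, Real.exp_lt_one_iff]; linarith
  let S : ℕ → ℕ := fun n => ⌊(n : ℝ) ^ ((1 : ℝ) / 20)⌋₊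
  have hS : Tendsto S atTop atTop :=
    tendsto_nat_floor_atTop.comp
      ((tendsto_rpow_atTop (by norm_num)).comp tendsto_natCast_atTop_atTop)
  have hpow : ∀ n : ℕ, ((n : ℝ) ^ ((1 : ℝ) / 20)) ^ 20 = n := by
    intro n
    rw [← Real.rpow_natCast, ← Real.rpow_mul (by positivity)]; norm_num
  have hSle : ∀ n, (S n) ^ 20 ≤ n := by
    intro n
    have h1 : (S n : ℝ) ≤ (n : ℝ) ^ ((1 : ℝ) / 20) := Nat.floor_le (by positivity)
    have h2 : (S n : ℝ) ^ 20 ≤ n := by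
      calc _ ≤ ((n : ℝ) ^ ((1 : ℝ) / 20)) ^ 20 := by gcongr
        _ = n := hpow n
    exact_mod_cast h2
  have hSge : ∀ n, 1 ≤ S n → (n : ℝ) ≤ (2 * (S n : ℝ)) ^ 20 := by
    intro n hn
    have h1 : (n : ℝ) ^ ((1 : ℝ) / 20) < S n + 1 := Nat.lt_floor_add_one _
    have hn' : (1 : ℝ) ≤ S n := by exact_mod_cast hn
    calc (n : ℝ) = ((n : ℝ) ^ ((1 : ℝ) / 20)) ^ 20 := (hpow n).symm
      _ ≤ _ := by gcongr; linarith
  let g : ℕ → ℝ := fun s => 2 ^ 42 * ((1 / (s : ℝ)) ^ 2 + (s : ℝ) ^ 22 * ρ ^ s) ^ 2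
    + 2 ^ 122 * ((s : ℝ) ^ 120 * p ^ s)
  have hg : Tendsto g atTop (nhds 0) := by
    have t1 : Tendsto (fun s : ℕ => (s : ℝ) ^ 22 * ρ ^ s) atTop (nhds 0) :=
      tendsto_pow_const_mul_const_pow_of_abs_lt_one 22 (by rw [abs_of_pos hρ0]; exact hρ1)
    have t2 : Tendsto (fun s : ℕ => (s : ℝ) ^ 120 * p ^ s) atTop (nhds 0) :=
      tendsto_pow_const_mul_const_pow_of_abs_lt_one 120 (by rw [abs_of_nonneg hp0]; exact hp1)
    have t3 : Tendsto (fun s : ℕ => (1 / (s : ℝ))) atTop (nhds 0) :=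
      tendsto_one_div_atTop_nhds_zero_nat
    have := ((((t3.pow 2).add t1).pow 2).const_mul (2 ^ 42)).add (t2.const_mul (2 ^ 122))
    simpa [g] using this
  refine squeeze_zero' (Eventually.of_forall fun n => by positivity) ?_ (hg.comp hS)
  filter_upwards [hS.eventually_ge_atTop 18] with n hn
  have hb := combine μ c hc d hd hcf p hp0 hp1.le hp n (S n) hn (hSle n)
  have hnS := hSge n (by omega)
  have hS0 : (0 : ℝ) < S n := by exact_mod_cast (by omega : 0 < S n)
  simp only [Function.comp, g]
  generalize S n = s at *
  refine (mul_le_mul_of_nonneg_left hb (by positivity)).trans ?_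
  rw [← hρ]
  calc _ ≤ ((2 * (s : ℝ)) ^ 20) ^ 2 * ((2 * (s : ℝ) ^ 2) * (2 * (s : ℝ) ^ 2) *
        ((1 / (s : ℝ) ^ 24 + ρ ^ s) * (1 / (s : ℝ) ^ 24 + ρ ^ s))
      + (2 * ((2 * (s : ℝ)) ^ 20) ^ 2) * (2 * ((2 * (s : ℝ)) ^ 20) ^ 2) * p ^ s) := by gcongr
    _ = _ := by
      have : (1 : ℝ) / (s : ℝ) ^ 24 = (1 / (s : ℝ)) ^ 2 / (s : ℝ) ^ 22 := by
        field_simp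
      rw [this]
      generalize ρ ^ s = X
      generalize p ^ s = Y
      field_simp
end
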